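/- arXiv:1609.07337 — 14 statements merged into one kernel-verified Lean document; each statement's English description precedes it below -/
import Mathlib

section
/- Let 𝒞 ⊆ X be a closed convex set and x ∈ D(𝒞). Then for every h ∈ H the point x + ιh belongs to D(𝒞), so the map m_{x,𝒞} : H → H, m_{x,𝒞}(h) := m(x + ιh, 𝒞), is well defined; moreover it is Lipschitz continuous with Lipschitz constant at most 1, i.e. |m(x + ιh, 𝒞) − m(x + ιk, 𝒞)|_H ≤ |h − k|_H for all h, k ∈ H. -/
open scoped ENNReal RealInnerProductSpace
open Filter Topology

variable {X H : Type*}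
  [NormedAddCommGroup X] [NormedSpace ℝ X] [CompleteSpace X]
  [NormedAddCommGroup H] [InnerProductSpace ℝ H] [CompleteSpace H]

/-- The distance along `H` from `x` to the set `C`, valued in `[0, +∞]`
(the infimum over the empty set being `+∞`). -/
noncomputable def dH (ι : H →L[ℝ] X) (C : Set X) (x : X) : ℝ≥0∞ :=
  ⨅ h ∈ {h : H | x - ι h ∈ C}, ENNReal.ofReal ‖h‖

/-- The set `D(C)` of points `x ∈ X` such that `H ∩ (x - C) ≠ ∅`. -/
def DSet (ι : H →L[ℝ] X) (C : Set X) : Set X := {x : X | ∃ h : H, x - ι h ∈ C}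

/-- The variational inequality for an element of minimal norm of a convex set. -/
theorem Convex.inner_sub_nonneg_of_norm_le {E : Type*} [NormedAddCommGroup E]
    [InnerProductSpace ℝ E] {K : Set E} (hK : Convex ℝ K) {m w : E} (hm : m ∈ K)
    (hmin : ∀ v ∈ K, ‖m‖ ≤ ‖v‖) (hw : w ∈ K) : 0 ≤ ⟪m, w - m⟫ := by
  have : Nonempty K := ⟨⟨m, hm⟩⟩
  have hinf : ‖(0 : E) - m‖ = ⨅ v : K, ‖(0 : E) - v‖ := by
    refine le_antisymm (le_ciInf fun v => by simpa using hmin v v.2) ?_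
    exact ciInf_le (f := fun v : K => ‖(0 : E) - v‖)
      ⟨0, by rintro _ ⟨v, rfl⟩; exact norm_nonneg _⟩ ⟨m, hm⟩
  simpa using (norm_eq_iInf_iff_real_inner_le_zero hK hm).1 hinf w hw

/-- The vectors `u` with `y - f u` in a convex set form a convex set. -/
theorem Convex.setOf_sub_map_mem {E F : Type*} [AddCommGroup E] [Module ℝ E]
    [AddCommGroup F] [Module ℝ F] {C : Set F} (hC : Convex ℝ C) (f : E →ₗ[ℝ] F) (y : F) :
    Convex ℝ {u : E | y - f u ∈ C} := by
  intro u hu v hv a b ha hb hab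
  have hmem := hC hu hv ha hb hab
  have heq : a • (y - f u) + b • (y - f v) = y - f (a • u + b • v) := by
    obtain rfl : b = 1 - a := by linarith
    simp only [map_add, map_smul]
    module
  rwa [heq] at hmem

/-- Let `C ⊆ X` be closed and convex and `x ∈ D(C)`. Then `x + ιh ∈ D(C)`
for every `h ∈ H`, so the map `h ↦ m(x + ιh, C)` is well defined; moreover it is Lipschitz
with constant at most `1`: if `mh` and `mk` are the minimal-norm elements of
`H ∩ (x + ιh - C)` and `H ∩ (x + ιk - C)` respectively, then `|mh - mk|_H ≤ |h - k|_H`. -/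
theorem min_norm_elem_lipschitz (ι : H →L[ℝ] X) (hι : Function.Injective ι)
    (C : Set X) (hCclosed : IsClosed C) (hCconv : Convex ℝ C)
    (x : X) (hx : x ∈ DSet ι C) :
    (∀ h : H, x + ι h ∈ DSet ι C) ∧
      ∀ (h k mh mk : H),
        (x + ι h) - ι mh ∈ C → (∀ h' : H, (x + ι h) - ι h' ∈ C → ‖mh‖ ≤ ‖h'‖) →
        (x + ι k) - ι mk ∈ C → (∀ h' : H, (x + ι k) - ι h' ∈ C → ‖mk‖ ≤ ‖h'‖) →
        ‖mh - mk‖ ≤ ‖h - k‖ := by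
  refine ⟨fun h => ?_, fun h k mh mk hmh hminh hmk hmink => ?_⟩
  · obtain ⟨g, hg⟩ := hx
    refine ⟨g + h, ?_⟩
    rwa [map_add, add_sub_add_right_eq_sub]
  · have ih : 0 ≤ ⟪mh, (h - k + mk) - mh⟫ := by
      refine (hCconv.setOf_sub_map_mem ι.toLinearMap (x + ι h)).inner_sub_nonneg_of_norm_le
        hmh hminh ?_
      have heq : x + ι h - ι (h - k + mk) = x + ι k - ι mk := by
        simp only [map_add, map_sub]
        abel
      change x + ι h - ι (h - k + mk) ∈ C
      rwa [heq]
    have ik : 0 ≤ ⟪mk, (k - h + mh) - mk⟫ := by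
      refine (hCconv.setOf_sub_map_mem ι.toLinearMap (x + ι k)).inner_sub_nonneg_of_norm_le
        hmk hmink ?_
      have heq : x + ι k - ι (k - h + mh) = x + ι h - ι mh := by
        simp only [map_add, map_sub]
        abel
      change x + ι k - ι (k - h + mh) ∈ C
      rwa [heq]
    have hsq : ‖mh - mk‖ * ‖mh - mk‖ ≤ ⟪mh - mk, h - k⟫ := by
      rw [← real_inner_self_eq_norm_mul_norm]
      simp only [inner_sub_left, inner_sub_right, inner_add_right] at ih ik ⊢
      linarith [real_inner_comm mh mk]
    by_contra! hlt
    nlinarith [real_inner_le_norm (mh - mk) (h - k), norm_nonneg (h - k)]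
end

section
/- Let 𝒞 ⊆ X be a closed convex set, x ∈ D(𝒞) and h ∈ H. Then ⟨m(x + ιh, 𝒞) − m(x, 𝒞), h⟩_H ≥ 0. -/
open scoped ENNReal RealInnerProductSpace
open Filter Topology

variable {X H : Type*}
  [NormedAddCommGroup X] [NormedSpace ℝ X] [CompleteSpace X]
  [NormedAddCommGroup H] [InnerProductSpace ℝ H] [CompleteSpace H]

/-- An element `u` of minimal norm in a convex set `K` satisfies `⟪u, v - u⟫ ≥ 0` for all
`v ∈ K`. -/
theorem inner_sub_nonneg_of_norm_min {E : Type*} [NormedAddCommGroup E] [InnerProductSpace ℝ E]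
    {K : Set E} (hK : Convex ℝ K) {u v : E} (hu : u ∈ K) (hmin : ∀ w ∈ K, ‖u‖ ≤ ‖w‖)
    (hv : v ∈ K) : 0 ≤ ⟪u, v - u⟫ := by
  have : Nonempty K := ⟨⟨u, hu⟩⟩
  have hinf : ‖(0 : E) - u‖ = ⨅ w : K, ‖(0 : E) - w‖ := by
    simp only [zero_sub, norm_neg]
    refine le_antisymm (le_ciInf fun w => hmin w w.2) ?_
    exact ciInf_le (f := fun w : K => ‖(w : E)‖)
      ⟨0, Set.forall_mem_range.2 fun w => norm_nonneg _⟩ ⟨u, hu⟩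
  have h := (norm_eq_iInf_iff_real_inner_le_zero hK hu).1 hinf v hv
  rw [zero_sub, inner_neg_left] at h
  linarith

/-- The set `H ∩ (x - C)` is convex when `C` is. -/
theorem convex_setOf_sub_map_mem {X H : Type*} [AddCommGroup X] [Module ℝ X]
    [AddCommGroup H] [Module ℝ H] (f : H →ₗ[ℝ] X) {C : Set X} (hC : Convex ℝ C) (x : X) :
    Convex ℝ {h : H | x - f h ∈ C} := by
  intro a ha b hb s t hs ht hst
  have h := hC ha hb hs ht hst
  have e : x - f (s • a + t • b) = s • (x - f a) + t • (x - f b) := by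
    rw [map_add, map_smul, map_smul]
    nth_rewrite 1 [← one_smul ℝ x]
    rw [← hst]
    module
  rwa [← e] at h

/-- Let `C ⊆ X` be closed and convex, `x ∈ D(C)` and `h ∈ H`. If `m` is the
minimal-norm element of `H ∩ (x - C)` and `mh` is the minimal-norm element of
`H ∩ (x + ιh - C)`, then `⟪m(x + ιh, C) - m(x, C), h⟫_H ≥ 0`. -/
theorem inner_min_norm_elem_sub_nonneg (ι : H →L[ℝ] X) (hι : Function.Injective ι)
    (C : Set X) (hCclosed : IsClosed C) (hCconv : Convex ℝ C)
    (x : X) (hx : x ∈ DSet ι C) (h : H)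
    (m : H) (hm : x - ι m ∈ C) (hmmin : ∀ h' : H, x - ι h' ∈ C → ‖m‖ ≤ ‖h'‖)
    (mh : H) (hmh : (x + ι h) - ι mh ∈ C)
    (hmhmin : ∀ h' : H, (x + ι h) - ι h' ∈ C → ‖mh‖ ≤ ‖h'‖) :
    0 ≤ ⟪mh - m, h⟫ := by
  have h₁ := inner_sub_nonneg_of_norm_min (convex_setOf_sub_map_mem ι.toLinearMap hCconv x)
    (u := m) (v := mh - h) hm hmmin (by
      have e : x - ι (mh - h) = x + ι h - ι mh := by rw [map_sub]; abel
      change x - ι (mh - h) ∈ C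
      rwa [e])
  have h₂ := inner_sub_nonneg_of_norm_min (convex_setOf_sub_map_mem ι.toLinearMap hCconv (x + ι h))
    (u := mh) (v := m + h) hmh hmhmin (by
      have e : x + ι h - ι (m + h) = x - ι m := by rw [map_add]; abel
      change x + ι h - ι (m + h) ∈ C
      rwa [e])
  have h₃ : 0 ≤ ⟪mh - m, mh - m⟫ := real_inner_self_nonneg
  simp only [inner_sub_left, inner_sub_right, inner_add_right] at h₁ h₂ h₃ ⊢
  linarith
end

section
/- Let 𝒞 ⊆ X be a closed convex set, x ∈ D(𝒞) and h ∈ H. Then −|h|_H² ≤ d_H(x + ιh, 𝒞)² − d_H(x, 𝒞)² − 2⟨m(x,𝒞), h⟩_H ≤ |h|_H² (all quantities being finite real numbers). -/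
open scoped ENNReal RealInnerProductSpace
open Filter Topology

variable {X H : Type*}
  [NormedAddCommGroup X] [NormedSpace ℝ X] [CompleteSpace X]
  [NormedAddCommGroup H] [InnerProductSpace ℝ H] [CompleteSpace H]

theorem dH_le_norm (ι : H →L[ℝ] X) {C : Set X} {x : X} {k : H} (hk : x - ι k ∈ C) :
    dH ι C x ≤ ENNReal.ofReal ‖k‖ :=
  iInf₂_le k hk

theorem dH_ne_top (ι : H →L[ℝ] X) {C : Set X} {x : X} {k : H} (hk : x - ι k ∈ C) :
    dH ι C x ≠ ⊤ :=
  ne_top_of_le_ne_top ENNReal.ofReal_ne_top (dH_le_norm ι hk)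

theorem dH_toReal_le_norm (ι : H →L[ℝ] X) {C : Set X} {x : X} {k : H} (hk : x - ι k ∈ C) :
    (dH ι C x).toReal ≤ ‖k‖ :=
  ENNReal.toReal_le_of_le_ofReal (norm_nonneg k) (dH_le_norm ι hk)

theorem le_dH_toReal (ι : H →L[ℝ] X) {C : Set X} {x : X} {r : ℝ} (htop : dH ι C x ≠ ⊤)
    (hr : ∀ k : H, x - ι k ∈ C → r ≤ ‖k‖) : r ≤ (dH ι C x).toReal :=
  (ENNReal.ofReal_le_iff_le_toReal htop).1
    (le_iInf₂ fun k hk => ENNReal.ofReal_le_ofReal (hr k hk))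

/-- The variational inequality for the element of minimal norm of a convex set. -/
theorem real_inner_sub_nonneg_of_norm_minimal {E : Type*} [NormedAddCommGroup E]
    [InnerProductSpace ℝ E] {K : Set E} (hK : Convex ℝ K) {m k : E} (hm : m ∈ K)
    (hmin : ∀ k' ∈ K, ‖m‖ ≤ ‖k'‖) (hk : k ∈ K) : 0 ≤ ⟪m, k - m⟫ := by
  have key : ⟪(0 : E) - m, k - m⟫ ≤ 0 := by
    refine (norm_eq_iInf_iff_real_inner_le_zero hK hm).1 ?_ k hk
    have : Nonempty K := ⟨⟨m, hm⟩⟩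
    refine le_antisymm (le_ciInf fun w => by simpa using hmin w w.2) ?_
    exact ciInf_le ⟨0, by rintro _ ⟨w, rfl⟩; exact norm_nonneg _⟩ (⟨m, hm⟩ : K)
  simpa using key

/-- Let `C ⊆ X` be closed and convex, `x ∈ D(C)` and `h ∈ H`. If `m` is the
minimal-norm element of `H ∩ (x - C)`, then all the distances involved are finite and
`-|h|_H² ≤ d_H(x + ιh, C)² - d_H(x, C)² - 2⟪m, h⟫_H ≤ |h|_H²`. -/
theorem dH_sq_sub_dH_sq_bounds (ι : H →L[ℝ] X) (hι : Function.Injective ι)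
    (C : Set X) (hCclosed : IsClosed C) (hCconv : Convex ℝ C)
    (x : X) (hx : x ∈ DSet ι C) (h : H)
    (m : H) (hm : x - ι m ∈ C) (hmmin : ∀ h' : H, x - ι h' ∈ C → ‖m‖ ≤ ‖h'‖) :
    dH ι C x ≠ ⊤ ∧ dH ι C (x + ι h) ≠ ⊤ ∧
      -‖h‖ ^ 2 ≤ (dH ι C (x + ι h)).toReal ^ 2 - (dH ι C x).toReal ^ 2 - 2 * ⟪m, h⟫ ∧
      (dH ι C (x + ι h)).toReal ^ 2 - (dH ι C x).toReal ^ 2 - 2 * ⟪m, h⟫ ≤ ‖h‖ ^ 2 := by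
  have hmh : x + ι h - ι (m + h) ∈ C := by
    simpa only [map_add, add_sub_add_right_eq_sub] using hm
  have hK : Convex ℝ {k : H | x - ι k ∈ C} := by
    intro a ha b hb s t hs ht hst
    have hab := hCconv ha hb hs ht hst
    have heq : x - ι (s • a + t • b) = s • (x - ι a) + t • (x - ι b) := by
      conv_lhs => rw [← one_smul ℝ x, ← hst]
      simp only [map_add, map_smul]
      module
    simpa only [Set.mem_ofPred_eq, heq] using hab
  have hx_top := dH_ne_top ι hm
  have hxh_top := dH_ne_top ι hmh
  have hdx : (dH ι C x).toReal = ‖m‖ :=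
    le_antisymm (dH_toReal_le_norm ι hm) (le_dH_toReal ι hx_top hmmin)
  have hupper : (dH ι C (x + ι h)).toReal ^ 2 ≤ ‖m + h‖ ^ 2 :=
    pow_le_pow_left₀ ENNReal.toReal_nonneg (dH_toReal_le_norm ι hmh) 2
  have hlower : ‖m‖ ^ 2 + 2 * ⟪m, h⟫ ≤ (dH ι C (x + ι h)).toReal ^ 2 := by
    refine (Real.sqrt_le_left ENNReal.toReal_nonneg).1 (le_dH_toReal ι hxh_top fun k hk => ?_)
    refine (Real.sqrt_le_left (norm_nonneg k)).2 ?_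
    have hkh : x - ι (k - h) ∈ C := by
      convert hk using 1
      rw [map_sub]
      abel
    have hvar := real_inner_sub_nonneg_of_norm_minimal hK hm hmmin hkh
    have hexp := norm_add_sq_real m (k - m)
    rw [add_sub_cancel] at hexp
    simp only [inner_sub_right] at hvar hexp
    nlinarith [sq_nonneg ‖k - m‖]
  rw [norm_add_sq_real] at hupper
  refine ⟨hx_top, hxh_top, ?_, ?_⟩
  · rw [hdx]
    linarith [sq_nonneg ‖h‖]
  · rw [hdx]
    linarith
end

section
/- Let 𝒞 ⊆ X be a closed convex set and x ∈ D(𝒞). Then the function F : H → ℝ defined by F(h) := d_H(x + ιh, 𝒞)² is real-valued and Fréchet differentiable at every h ∈ H, with gradient (in H) given by ∇F(h) = 2 m(x + ιh, 𝒞). In particular the square of the H-distance from 𝒞 is differentiable along H at every point of D(𝒞), with H-gradient 2 m(·,𝒞). -/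
open scoped ENNReal RealInnerProductSpace
open Filter Topology

variable {X H : Type*}
  [NormedAddCommGroup X] [NormedSpace ℝ X] [CompleteSpace X]
  [NormedAddCommGroup H] [InnerProductSpace ℝ H] [CompleteSpace H]

section

variable {E F : Type*} [NormedAddCommGroup E] [NormedSpace ℝ E]
  [NormedAddCommGroup F] [InnerProductSpace ℝ F]

theorem dH_ne_top_s5 {ι : F →L[ℝ] E} {C : Set E} {x : E} (hx : x ∈ DSet ι C) : dH ι C x ≠ ⊤ := by
  obtain ⟨h, hh⟩ := hx
  exact ne_top_of_le_ne_top ENNReal.ofReal_ne_top (iInf₂_le h hh)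

theorem toReal_dH_le {ι : F →L[ℝ] E} {C : Set E} {x : E} {h : F} (hh : x - ι h ∈ C) :
    (dH ι C x).toReal ≤ ‖h‖ :=
  ENNReal.toReal_le_of_le_ofReal (norm_nonneg h) (iInf₂_le h hh)

theorem le_toReal_dH {ι : F →L[ℝ] E} {C : Set E} {x : E} {c : ℝ} (hx : x ∈ DSet ι C)
    (hc : ∀ h : F, x - ι h ∈ C → c ≤ ‖h‖) : c ≤ (dH ι C x).toReal :=
  (ENNReal.ofReal_le_iff_le_toReal (dH_ne_top_s5 hx)).1 <|
    le_iInf₂ fun h hh => ENNReal.ofReal_le_ofReal (hc h hh)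

theorem le_toReal_dH_sq {ι : F →L[ℝ] E} {C : Set E} {x : E} {c : ℝ} (hx : x ∈ DSet ι C)
    (hc : ∀ h : F, x - ι h ∈ C → c ≤ ‖h‖ ^ 2) : c ≤ (dH ι C x).toReal ^ 2 :=
  (Real.sqrt_le_iff.1 <| le_toReal_dH hx fun h hh =>
    Real.sqrt_le_iff.2 ⟨norm_nonneg h, hc h hh⟩).2

theorem add_mem_DSet {ι : F →L[ℝ] E} {C : Set E} {x : E} (hx : x ∈ DSet ι C) (k : F) :
    x + ι k ∈ DSet ι C := by
  obtain ⟨h, hh⟩ := hx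
  refine ⟨h + k, ?_⟩
  rwa [map_add, add_sub_add_right_eq_sub]

/-- The variational inequality for an element of minimal norm of a convex set. -/
theorem inner_sub_nonneg_of_norm_minimal {A : Set F} (hA : Convex ℝ A) {m a : F} (hm : m ∈ A)
    (hmin : ∀ b ∈ A, ‖m‖ ≤ ‖b‖) (ha : a ∈ A) : 0 ≤ ⟪m, a - m⟫ := by
  have : Nonempty A := ⟨⟨m, hm⟩⟩
  have key := (norm_eq_iInf_iff_real_inner_le_zero hA (u := 0) hm).1 ?_ a ha
  · rw [zero_sub, inner_neg_left] at key
    linarith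
  · refine le_antisymm (le_ciInf fun b => ?_) (ciInf_le ⟨0, ?_⟩ (⟨m, hm⟩ : A))
    · simpa using hmin b b.2
    · rintro _ ⟨b, rfl⟩
      exact norm_nonneg _

end

/-- A function with a quadratic first-order remainder has a gradient. -/
theorem hasGradientAt_of_abs_sub_le_sq {f : H → ℝ} {g h : H}
    (hf : ∀ k, |f k - f h - ⟪g, k - h⟫| ≤ ‖k - h‖ ^ 2) : HasGradientAt f g h := by
  rw [hasGradientAt_iff_isLittleO]
  refine (Asymptotics.IsBigO.of_bound 1 (Eventually.of_forall fun k => ?_)).trans_isLittleO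
    (Asymptotics.isLittleO_pow_sub_sub h one_lt_two)
  simpa using hf k

/-- Let `C ⊆ X` be closed and convex and `x ∈ D(C)`. Then the function
`F : H → ℝ`, `F(h) = d_H(x + ιh, C)²`, is real-valued (the distances are finite) and
Fréchet differentiable at every `h ∈ H`, with gradient `∇F(h) = 2 m(x + ιh, C)`, where
`m(x + ιh, C)` is the minimal-norm element of `H ∩ (x + ιh - C)`. -/
theorem hasGradientAt_dH_sq (ι : H →L[ℝ] X) (hι : Function.Injective ι)
    (C : Set X) (hCclosed : IsClosed C) (hCconv : Convex ℝ C)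
    (x : X) (hx : x ∈ DSet ι C) :
    (∀ k : H, dH ι C (x + ι k) ≠ ⊤) ∧
      ∀ (h mh : H), (x + ι h) - ι mh ∈ C →
        (∀ h' : H, (x + ι h) - ι h' ∈ C → ‖mh‖ ≤ ‖h'‖) →
        HasGradientAt (fun k : H => (dH ι C (x + ι k)).toReal ^ 2) ((2 : ℝ) • mh) h := by
  refine ⟨fun k => dH_ne_top_s5 (add_mem_DSet hx k), fun h m hm hmin => ?_⟩
  have hval : (dH ι C (x + ι h)).toReal = ‖m‖ :=
    le_antisymm (toReal_dH_le hm) (le_toReal_dH (add_mem_DSet hx h) hmin)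
  have hconv : Convex ℝ {a : H | (x + ι h) - ι a ∈ C} := by
    intro a ha b hb s t hs ht hst
    have := hCconv ha hb hs ht hst
    rw [smul_sub, smul_sub, sub_add_sub_comm, ← add_smul, hst, one_smul] at this
    simpa using this
  refine hasGradientAt_of_abs_sub_le_sq fun k => ?_
  have hupper : (dH ι C (x + ι k)).toReal ^ 2 ≤ ‖m + (k - h)‖ ^ 2 := by
    refine pow_le_pow_left₀ ENNReal.toReal_nonneg (toReal_dH_le ?_) 2
    convert hm using 1
    rw [map_add, map_sub]
    abel
  have hlower : ‖m‖ ^ 2 + 2 * ⟪m, k - h⟫ ≤ (dH ι C (x + ι k)).toReal ^ 2 := by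
    refine le_toReal_dH_sq (add_mem_DSet hx k) fun b hb => ?_
    have hmem : b - (k - h) ∈ {a : H | (x + ι h) - ι a ∈ C} := by
      change (x + ι h) - ι (b - (k - h)) ∈ C
      convert hb using 1
      rw [map_sub, map_sub]
      abel
    have hinner := inner_sub_nonneg_of_norm_minimal hconv hm hmin hmem
    have hsq := norm_add_sq_real m (b - m)
    have hsplit : ⟪m, b - m⟫ = ⟪m, b - (k - h) - m⟫ + ⟪m, k - h⟫ := by
      rw [← inner_add_right]
      congr 1
      abel
    rw [add_sub_cancel] at hsq
    nlinarith [sq_nonneg ‖b - m‖]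
  rw [norm_add_sq_real] at hupper
  rw [hval, real_inner_smul_left, abs_le]
  constructor <;> nlinarith [sq_nonneg ‖k - h‖]
end

section
/- Let 𝒞 ⊆ X be a closed convex set. Then the extended-real-valued function x ↦ d_H(x,𝒞)² from X to [0,+∞] is convex: for all x, y ∈ X and λ ∈ [0,1], d_H(λx + (1−λ)y, 𝒞)² ≤ λ d_H(x,𝒞)² + (1−λ) d_H(y,𝒞)² (with the usual conventions in [0,+∞]). -/
open scoped ENNReal RealInnerProductSpace
open Filter Topology

variable {X H : Type*}
  [NormedAddCommGroup X] [NormedSpace ℝ X] [CompleteSpace X]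
  [NormedAddCommGroup H] [InnerProductSpace ℝ H] [CompleteSpace H]

/-- The distance along `H` to a convex set is convex, for positive weights. -/
theorem dH_convex_combo_le (ι : H →L[ℝ] X) {C : Set X} (hC : Convex ℝ C) (x y : X)
    {a b : ℝ} (ha : 0 < a) (hb : 0 < b) (hab : a + b = 1) :
    dH ι C (a • x + b • y) ≤ ENNReal.ofReal a * dH ι C x + ENNReal.ofReal b * dH ι C y := by
  have ha' : ENNReal.ofReal a ≠ 0 := by simpa using ha
  have hb' : ENNReal.ofReal b ≠ 0 := by simpa using hb
  conv_rhs => unfold dH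
  simp only [ENNReal.mul_iInf_of_ne ha' ENNReal.ofReal_ne_top,
    ENNReal.mul_iInf_of_ne hb' ENNReal.ofReal_ne_top, ENNReal.iInf_add, ENNReal.add_iInf]
  refine le_iInf fun k => le_iInf fun hk => le_iInf fun h => le_iInf fun hh => ?_
  have hmem : a • x + b • y - ι (a • h + b • k) ∈ C := by
    have hmem' := hC hh hk ha.le hb.le hab
    convert hmem' using 1
    simp only [map_add, map_smul, smul_sub]
    abel
  calc dH ι C (a • x + b • y) ≤ ENNReal.ofReal ‖a • h + b • k‖ :=
        iInf₂_le (f := fun (h : H) (_ : h ∈ {h : H | a • x + b • y - ι h ∈ C}) =>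
          ENNReal.ofReal ‖h‖) _ hmem
    _ ≤ ENNReal.ofReal (a * ‖h‖ + b * ‖k‖) := by
      refine ENNReal.ofReal_le_ofReal ((norm_add_le _ _).trans_eq ?_)
      rw [norm_smul, norm_smul, Real.norm_of_nonneg ha.le, Real.norm_of_nonneg hb.le]
    _ = _ := by
      rw [ENNReal.ofReal_add (by positivity) (by positivity), ENNReal.ofReal_mul ha.le,
        ENNReal.ofReal_mul hb.le]

/-- Let `C ⊆ X` be closed and convex. Then the extended-real-valued
function `x ↦ d_H(x, C)²` from `X` to `[0, +∞]` is convex. -/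
theorem dH_sq_convex (ι : H →L[ℝ] X) (hι : Function.Injective ι)
    (C : Set X) (hCclosed : IsClosed C) (hCconv : Convex ℝ C) :
    ∀ (x y : X) (a : ℝ), 0 ≤ a → a ≤ 1 →
      dH ι C (a • x + (1 - a) • y) ^ 2 ≤
        ENNReal.ofReal a * dH ι C x ^ 2 + ENNReal.ofReal (1 - a) * dH ι C y ^ 2 := by
  intro x y a ha0 ha1
  rcases ha0.eq_or_lt with rfl | ha
  · simp
  rcases ha1.eq_or_lt with rfl | ha'
  · simp
  have hb : 0 < 1 - a := sub_pos.2 ha'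
  refine (pow_le_pow_left' (dH_convex_combo_le ι hCconv x y ha hb (by ring)) 2).trans ?_
  have hw : ENNReal.ofReal a + ENNReal.ofReal (1 - a) = 1 := by
    rw [← ENNReal.ofReal_add ha.le hb.le]
    simp
  simpa only [ENNReal.rpow_two] using
    ENNReal.rpow_arith_mean_le_arith_mean2_rpow _ _ (dH ι C x) (dH ι C y) hw one_le_two
end

section
/- Let f : X → ℝ ∪ {+∞} be proper, convex and lower semicontinuous, let α > 0, and let x ∈ X be such that f(x + ιh₀) < +∞ for some h₀ ∈ H. Then the function g_{α,x} : H → ℝ ∪ {+∞}, g_{α,x}(h) := f(x + ιh) + (1/(2α))|h|_H², has a unique global minimum point P(x,α) ∈ H. -/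
open scoped ENNReal RealInnerProductSpace
open Filter Topology

variable {X H : Type*}
  [NormedAddCommGroup X] [NormedSpace ℝ X] [CompleteSpace X]
  [NormedAddCommGroup H] [InnerProductSpace ℝ H] [CompleteSpace H]

/-- The Moreau–Yosida approximation along `H` of `f : X → ℝ ∪ {+∞}`
with parameter `α`. -/
noncomputable def moreauYosidaH (ι : H →L[ℝ] X) (f : X → EReal) (α : ℝ) (x : X) : EReal :=
  ⨅ h : H, f (x + ι h) + (((1 / (2 * α)) * ‖h‖ ^ 2 : ℝ) : EReal)

/-- A lower semicontinuous function which is bounded below and uniformly midpoint convex has a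
unique global minimum point on a complete normed space. -/
theorem existsUnique_forall_le_of_uniform_midpoint_convex {E : Type*} [NormedAddCommGroup E]
    [NormedSpace ℝ E] [CompleteSpace E] {g : E → EReal} (hlsc : LowerSemicontinuous g)
    {L γ : ℝ} (hγ : 0 < γ) (hL : ∀ h, (L : EReal) ≤ g h) (hfin : ∃ h, g h ≠ ⊤)
    (hmid : ∀ (h k : E) (s t : ℝ), g h ≤ s → g k ≤ t →
      g ((1 / 2 : ℝ) • h + (1 / 2 : ℝ) • k) ≤ ((s + t) / 2 - γ * ‖h - k‖ ^ 2 : ℝ)) :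
    ∃! p, ∀ h, g p ≤ g h := by
  have coe_toReal : ∀ h, g h ≠ ⊤ → ((g h).toReal : EReal) = g h := fun h hh =>
    EReal.coe_toReal hh fun hb => by simpa [hb] using hL h
  set S : Set ℝ := {v | ∃ h, g h ≤ v}
  have hne : S.Nonempty := hfin.imp' (fun h => (g h).toReal) fun h hh => ⟨h, (coe_toReal h hh).ge⟩
  have hbdd : BddBelow S := ⟨L, fun v ⟨h, hv⟩ => EReal.coe_le_coe_iff.1 ((hL h).trans hv)⟩
  set m := sInf S
  have hm : ∀ h, (m : EReal) ≤ g h := fun h => by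
    by_cases hh : g h = ⊤
    · simp [hh]
    · rw [← coe_toReal h hh]
      exact EReal.coe_le_coe_iff.2 (csInf_le hbdd ⟨h, (coe_toReal h hh).ge⟩)
  have hdist : ∀ (h k : E) (s t : ℝ), g h ≤ s → g k ≤ t → γ * ‖h - k‖ ^ 2 ≤ (s + t) / 2 - m := by
    intro h k s t hs ht
    have := EReal.coe_le_coe_iff.1 ((hm _).trans (hmid h k s t hs ht))
    linarith
  have hseq : ∀ n : ℕ, ∃ h, g h ≤ (m + 1 / ((n : ℝ) + 1) : ℝ) := fun n => by
    obtain ⟨v, ⟨h, hv⟩, hlt⟩ := exists_lt_of_csInf_lt hne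
      (lt_add_of_pos_right m (Nat.one_div_pos_of_nat (α := ℝ) (n := n)))
    exact ⟨h, hv.trans (EReal.coe_le_coe_iff.2 hlt.le)⟩
  choose u hu using hseq
  have hcauchy : CauchySeq u := by
    refine Metric.cauchySeq_iff'.2 fun ε hε => ?_
    obtain ⟨N, hN⟩ := exists_nat_one_div_lt (show 0 < γ * ε ^ 2 by positivity)
    refine ⟨N, fun n hn => ?_⟩
    have h1 := hdist _ _ _ _ (hu n) (hu N)
    have h2 : 1 / ((n : ℝ) + 1) ≤ 1 / ((N : ℝ) + 1) := Nat.one_div_le_one_div hn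
    rw [dist_eq_norm]
    refine lt_of_pow_lt_pow_left₀ 2 hε.le (lt_of_mul_lt_mul_left ?_ hγ.le)
    linarith
  obtain ⟨p, hp⟩ := cauchySeq_tendsto_of_complete hcauchy
  have hpm : g p ≤ m := by
    by_contra! hlt
    obtain ⟨y, hmy, hy⟩ := EReal.lt_iff_exists_real_btwn.1 hlt
    have hev := hp.eventually (hlsc p y hy)
    have hlim : Tendsto (fun n : ℕ => m + 1 / ((n : ℝ) + 1)) atTop (𝓝 (m + 0)) :=
      tendsto_const_nhds.add tendsto_one_div_add_atTop_nhds_zero_nat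
    have : y ≤ m + 0 := ge_of_tendsto hlim <| hev.mono fun n hn =>
      EReal.coe_le_coe_iff.1 (hn.le.trans (hu n))
    have := EReal.coe_lt_coe_iff.1 hmy
    linarith
  refine ⟨p, fun h => hpm.trans (hm h), fun q hq => ?_⟩
  have h0 := hdist q p m m ((hq p).trans hpm) hpm
  have h1 : ‖q - p‖ ^ 2 ≤ 0 := by
    refine le_of_mul_le_mul_left ?_ hγ
    linarith
  exact sub_eq_zero.1 (norm_eq_zero.1 (pow_eq_zero_iff two_ne_zero |>.1
    (le_antisymm h1 (sq_nonneg _))))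

/-- A convex function which is lower semicontinuous and finite at a point decreases at most
linearly away from that point. -/
theorem exists_sub_mul_norm_le_of_convex {E : Type*} [NormedAddCommGroup E] [NormedSpace ℝ E]
    {φ : E → EReal} {h₀ : E} {s₀ : ℝ} (hlsc : LowerSemicontinuousAt φ h₀) (hs₀ : φ h₀ = s₀)
    (hconv : ∀ (u v : E) (s t a b : ℝ), φ u ≤ s → φ v ≤ t → 0 ≤ a → 0 ≤ b → a + b = 1 →
      φ (a • u + b • v) ≤ (a * s + b * t : ℝ)) :
    ∃ C : ℝ, 0 ≤ C ∧ ∀ (h : E) (s : ℝ), φ h ≤ s → s₀ - 1 - C * ‖h - h₀‖ ≤ s := by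
  have hlt : ((s₀ - 1 : ℝ) : EReal) < φ h₀ := by
    rw [hs₀]
    exact EReal.coe_lt_coe_iff.2 (by linarith)
  obtain ⟨r, hr, hball⟩ := Metric.eventually_nhds_iff.1 (hlsc _ hlt)
  refine ⟨2 / r, by positivity, fun h s hs => ?_⟩
  by_cases hh : dist h h₀ < r
  · have h1 := EReal.coe_lt_coe_iff.1 ((hball hh).trans_le hs)
    have : 0 ≤ 2 / r * ‖h - h₀‖ := by positivity
    linarith
  · rw [dist_eq_norm, not_lt] at hh
    set d := ‖h - h₀‖ with hd
    have hd0 : 0 < d := hr.trans_le hh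
    set t := r / (2 * d) with ht
    have ht0 : 0 < t := by positivity
    have htd : t * d = r / 2 := by rw [ht]; field_simp
    have ht1 : t ≤ 1 := by rw [ht, div_le_one (by positivity)]; linarith
    have h1 := hconv h₀ h s₀ s (1 - t) t hs₀.le hs (by linarith) ht0.le (by ring)
    have h2 : dist ((1 - t) • h₀ + t • h) h₀ < r := by
      rw [dist_eq_norm, show (1 - t) • h₀ + t • h - h₀ = t • (h - h₀) by module, norm_smul,
        Real.norm_of_nonneg ht0.le, ← hd, htd]
      linarith
    have h3 := EReal.coe_lt_coe_iff.1 ((hball h2).trans_le h1)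
    have h4 : t * (2 / r * d) = 1 := by
      rw [show t * (2 / r * d) = t * d * (2 / r) by ring, htd]
      field_simp
    have h5 : s₀ - 2 / r * d ≤ s := by
      refine le_of_mul_le_mul_left ?_ ht0
      linarith [mul_sub t s₀ (2 / r * d)]
    linarith

/-- A proper convex lower semicontinuous function on a Hilbert space plus a positive multiple of
the squared norm has a unique global minimum point. -/
theorem existsUnique_forall_add_mul_norm_sq_le {E : Type*} [NormedAddCommGroup E]
    [InnerProductSpace ℝ E] [CompleteSpace E] {φ : E → EReal} (hlsc : LowerSemicontinuous φ)
    (hbot : ∀ h, φ h ≠ ⊥) (hfin : ∃ h, φ h ≠ ⊤)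
    (hconv : ∀ (u v : E) (a b : ℝ), 0 ≤ a → 0 ≤ b → a + b = 1 →
      φ (a • u + b • v) ≤ (a : EReal) * φ u + (b : EReal) * φ v)
    {c : ℝ} (hc : 0 < c) :
    ∃! p, ∀ h, φ p + ((c * ‖p‖ ^ 2 : ℝ) : EReal) ≤ φ h + ((c * ‖h‖ ^ 2 : ℝ) : EReal) := by
  have hepi : ∀ (u v : E) (s t a b : ℝ), φ u ≤ s → φ v ≤ t → 0 ≤ a → 0 ≤ b → a + b = 1 →
      φ (a • u + b • v) ≤ (a * s + b * t : ℝ) := by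
    intro u v s t a b hs ht ha hb hab
    refine (hconv u v a b ha hb hab).trans ?_
    push_cast
    exact add_le_add (mul_le_mul_of_nonneg_left hs (EReal.coe_nonneg.2 ha))
      (mul_le_mul_of_nonneg_left ht (EReal.coe_nonneg.2 hb))
  have hle : ∀ (h : E) (s : ℝ),
      φ h + ((c * ‖h‖ ^ 2 : ℝ) : EReal) ≤ s ↔ φ h ≤ (s - c * ‖h‖ ^ 2 : ℝ) := by
    intro h s
    rw [EReal.coe_sub, EReal.le_sub_iff_add_le (Or.inl (EReal.coe_ne_bot _))
      (Or.inl (EReal.coe_ne_top _))]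
  obtain ⟨h₀, hh₀⟩ := hfin
  obtain ⟨C, hC, hlow⟩ := exists_sub_mul_norm_le_of_convex (hlsc h₀)
    (EReal.coe_toReal hh₀ (hbot h₀)).symm hepi
  set s₀ := (φ h₀).toReal
  refine existsUnique_forall_le_of_uniform_midpoint_convex
    (g := fun h => φ h + ((c * ‖h‖ ^ 2 : ℝ) : EReal))
    (L := s₀ - 1 - C * ‖h₀‖ - C ^ 2 / (4 * c)) (γ := c / 4) ?_ (by positivity) ?_ ?_ ?_
  · refine hlsc.add' (Continuous.lowerSemicontinuous ?_) fun h =>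
      EReal.continuousAt_add (Or.inr (EReal.coe_ne_bot _)) (Or.inr (EReal.coe_ne_top _))
    exact continuous_coe_real_ereal.comp (by fun_prop)
  · intro h
    refine EReal.le_of_forall_lt_iff_le.1 fun s hs => ?_
    have h1 := hlow h _ ((hle h s).1 hs.le)
    have h2 : C * ‖h - h₀‖ ≤ C * (‖h‖ + ‖h₀‖) := mul_le_mul_of_nonneg_left (norm_sub_le _ _) hC
    have h3 : c * ‖h‖ ^ 2 - C * ‖h‖ + C ^ 2 / (4 * c) = c * (‖h‖ - C / (2 * c)) ^ 2 := by
      field_simp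
      ring
    have h4 : 0 ≤ c * (‖h‖ - C / (2 * c)) ^ 2 := by positivity
    exact EReal.coe_le_coe_iff.2 (by linarith)
  · exact ⟨h₀, EReal.add_ne_top hh₀ (EReal.coe_ne_top _)⟩
  · intro h k s t hs ht
    rw [hle] at hs ht ⊢
    refine (hepi h k _ _ (1 / 2) (1 / 2) hs ht (by norm_num) (by norm_num) (by norm_num)).trans
      (EReal.coe_le_coe_iff.2 ?_)
    have hpar := parallelogram_law_with_norm ℝ h k
    rw [← smul_add, norm_smul, Real.norm_of_nonneg (by norm_num)]
    linear_combination (c / 4) * hpar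

/-- Let `f : X → ℝ ∪ {+∞}` be proper, convex and lower semicontinuous,
`α > 0`, and `x ∈ X` such that `f(x + ιh₀) < +∞` for some `h₀ ∈ H`. Then the function
`g_{α,x}(h) = f(x + ιh) + (1/(2α))|h|_H²` has a unique global minimum point `P(x,α) ∈ H`. -/
theorem exists_unique_moreauYosida_min (ι : H →L[ℝ] X) (hι : Function.Injective ι)
    (f : X → EReal) (hbot : ∀ y : X, f y ≠ ⊥) (hproper : ∃ y : X, f y ≠ ⊤)
    (hconv : ∀ (x y : X) (a b : ℝ), 0 ≤ a → 0 ≤ b → a + b = 1 →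
      f (a • x + b • y) ≤ (a : EReal) * f x + (b : EReal) * f y)
    (hlsc : LowerSemicontinuous f)
    (α : ℝ) (hα : 0 < α) (x : X) (hx : ∃ h₀ : H, f (x + ι h₀) ≠ ⊤) :
    ∃! p : H, ∀ h : H,
      f (x + ι p) + (((1 / (2 * α)) * ‖p‖ ^ 2 : ℝ) : EReal) ≤
        f (x + ι h) + (((1 / (2 * α)) * ‖h‖ ^ 2 : ℝ) : EReal) := by
  refine existsUnique_forall_add_mul_norm_sq_le (φ := fun h => f (x + ι h))
    (hlsc.comp (by fun_prop)) (fun h => hbot _) hx (fun u v a b ha hb hab => ?_) (by positivity)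
  have hxab : x + ι (a • u + b • v) = a • (x + ι u) + b • (x + ι v) := by
    rw [map_add, map_smul, map_smul, smul_add, smul_add, add_add_add_comm, ← add_smul, hab,
      one_smul]
  simpa only [hxab] using hconv (x + ι u) (x + ι v) a b ha hb hab
end

section
/- Let f : X → ℝ ∪ {+∞} be proper, convex and lower semicontinuous, let α > 0, let x ∈ X be such that f(x + ιh₀) < +∞ for some h₀ ∈ H, and let p ∈ H. Then p = P(x,α) if and only if f(x + ιp) ≤ f(x + ιh) + (1/α)⟨p, h − p⟩_H for every h ∈ H. -/
open scoped ENNReal RealInnerProductSpace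
open Filter Topology

variable {X H : Type*}
  [NormedAddCommGroup X] [NormedSpace ℝ X] [CompleteSpace X]
  [NormedAddCommGroup H] [InnerProductSpace ℝ H] [CompleteSpace H]

theorem le_of_forall_le_add_mul {A B C : ℝ} (h : ∀ t : ℝ, 0 < t → t ≤ 1 → A ≤ B + t * C) :
    A ≤ B := by
  have hlim : Tendsto (fun t : ℝ => B + t * C) (𝓝[>] 0) (𝓝 B) := by
    have hcont : Continuous fun t : ℝ => B + t * C := by fun_prop
    simpa using (hcont.tendsto 0).mono_left nhdsWithin_le_nhds
  refine ge_of_tendsto hlim ?_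
  filter_upwards [Ioc_mem_nhdsGT (zero_lt_one (α := ℝ))] with t ht
  exact h t ht.1 ht.2

theorem norm_sq_add_two_mul_inner_sub_le {E : Type*} [NormedAddCommGroup E]
    [InnerProductSpace ℝ E] (p h : E) : ‖p‖ ^ 2 + 2 * ⟪p, h - p⟫ ≤ ‖h‖ ^ 2 := by
  have key := norm_add_sq_real p (h - p)
  rw [add_sub_cancel] at key
  nlinarith [sq_nonneg ‖h - p‖]

theorem norm_add_smul_sq_real {E : Type*} [NormedAddCommGroup E] [InnerProductSpace ℝ E]
    (p v : E) (t : ℝ) :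
    ‖p + t • v‖ ^ 2 = ‖p‖ ^ 2 + 2 * t * ⟪p, v⟫ + t ^ 2 * ‖v‖ ^ 2 := by
  rw [norm_add_sq_real, real_inner_smul_right, norm_smul, mul_pow, Real.norm_eq_abs, sq_abs]
  ring

/-- With `f` proper convex lower semicontinuous, `α > 0`,
`x` such that `f(x + ιh₀) < +∞` for some `h₀`, and `p ∈ H`: `p` is the minimizer `P(x,α)` of
`h ↦ f(x + ιh) + (1/(2α))|h|_H²` if and only if
`f(x + ιp) ≤ f(x + ιh) + (1/α)⟪p, h - p⟫_H` for every `h ∈ H`. -/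
theorem moreauYosida_min_iff (ι : H →L[ℝ] X) (hι : Function.Injective ι)
    (f : X → EReal) (hbot : ∀ y : X, f y ≠ ⊥) (hproper : ∃ y : X, f y ≠ ⊤)
    (hconv : ∀ (x y : X) (a b : ℝ), 0 ≤ a → 0 ≤ b → a + b = 1 →
      f (a • x + b • y) ≤ (a : EReal) * f x + (b : EReal) * f y)
    (hlsc : LowerSemicontinuous f)
    (α : ℝ) (hα : 0 < α) (x : X) (hx : ∃ h₀ : H, f (x + ι h₀) ≠ ⊤) (p : H) :
    (∀ h : H,
        f (x + ι p) + (((1 / (2 * α)) * ‖p‖ ^ 2 : ℝ) : EReal) ≤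
          f (x + ι h) + (((1 / (2 * α)) * ‖h‖ ^ 2 : ℝ) : EReal)) ↔
      (∀ h : H, f (x + ι p) ≤ f (x + ι h) + (((1 / α) * ⟪p, h - p⟫ : ℝ) : EReal)) := by
  have hc : 1 / α = 2 * (1 / (2 * α)) := by field_simp
  have hc0 : 0 < 1 / (2 * α) := by positivity
  rw [hc]
  generalize 1 / (2 * α) = c at hc0
  constructor
  · intro hmin h
    have hp : f (x + ι p) ≠ ⊤ := by
      obtain ⟨h₀, hh₀⟩ := hx
      intro htop
      have hle := hmin h₀
      rw [htop, EReal.top_add_coe, top_le_iff] at hle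
      exact EReal.add_ne_top hh₀ (EReal.coe_ne_top _) hle
    by_cases hh : f (x + ι h) = ⊤
    · rw [hh, EReal.top_add_coe]
      exact le_top
    lift f (x + ι p) to ℝ using ⟨hp, hbot _⟩ with A hA
    lift f (x + ι h) to ℝ using ⟨hh, hbot _⟩ with B hB
    norm_cast
    refine le_of_forall_le_add_mul (C := c * ‖h - p‖ ^ 2) fun t ht0 ht1 => ?_
    have hcomb : x + ι (p + t • (h - p)) = (1 - t) • (x + ι p) + t • (x + ι h) := by
      simp only [map_add, map_smul, map_sub]
      module
    have hconv_t := hconv (x + ι p) (x + ι h) (1 - t) t (by linarith) ht0.le (by ring)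
    rw [← hcomb, ← hA, ← hB] at hconv_t
    have hle := (hmin (p + t • (h - p))).trans (add_le_add_left hconv_t _)
    norm_cast at hle
    rw [norm_add_smul_sq_real] at hle
    refine le_of_mul_le_mul_left ?_ ht0
    linarith
  · intro hvar h
    refine (add_le_add_left (hvar h) _).trans ?_
    rw [add_assoc]
    refine add_le_add_right ?_ _
    norm_cast
    nlinarith [norm_sq_add_two_mul_inner_sub_le p h]
end

section
/- Let f : X → ℝ ∪ {+∞} be proper, convex and lower semicontinuous, let α > 0, and let x ∈ X be such that f(x + ιh₀) < +∞ for some h₀ ∈ H. Then for every h ∈ H the point x + ιh also satisfies this condition, and the map P_{x,α} : H → H, P_{x,α}(h) := P(x + ιh, α), is Lipschitz continuous with Lipschitz constant at most 1: |P(x + ιh, α) − P(x + ιk, α)|_H ≤ |h − k|_H for all h, k ∈ H. -/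
open scoped ENNReal RealInnerProductSpace
open Filter Topology

variable {X H : Type*}
  [NormedAddCommGroup X] [NormedSpace ℝ X] [CompleteSpace X]
  [NormedAddCommGroup H] [InnerProductSpace ℝ H] [CompleteSpace H]

/-- First-order optimality of a minimizer `p` of the regularized functional, tested in the
direction `d`. -/
theorem le_add_inner_of_regularized_min {ι : H →L[ℝ] X} {f : X → EReal}
    (hconv : ∀ (x y : X) (a b : ℝ), 0 ≤ a → 0 ≤ b → a + b = 1 →
      f (a • x + b • y) ≤ (a : EReal) * f x + (b : EReal) * f y)
    {c : ℝ} {y : X} {p d : H}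
    (hp : ∀ h' : H, f (y + ι p) + ((c * ‖p‖ ^ 2 : ℝ) : EReal) ≤
      f (y + ι h') + ((c * ‖h'‖ ^ 2 : ℝ) : EReal))
    {r s : ℝ} (hr : f (y + ι p) = r) (hs : f (y + ι (p + d)) = s) :
    r ≤ s + 2 * c * ⟪p, d⟫ := by
  have key : ∀ t ∈ Set.Ioo (0 : ℝ) 1, r ≤ s + 2 * c * ⟪p, d⟫ + t * (c * ‖d‖ ^ 2) := by
    rintro t ⟨ht0, ht1⟩
    have hmin := hp (p + t • d)
    have hc := hconv (y + ι p) (y + ι (p + d)) (1 - t) t (by linarith) ht0.le (by ring)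
    have hpt : (1 - t) • (y + ι p) + t • (y + ι (p + d)) = y + ι (p + t • d) := by
      simp only [map_add, map_smul]
      module
    rw [hpt, hr, hs] at hc
    rw [hr] at hmin
    have hle := hmin.trans (add_le_add_left hc _)
    norm_cast at hle
    rw [norm_add_sq_real, inner_smul_right, norm_smul, mul_pow, Real.norm_eq_abs, sq_abs] at hle
    refine le_of_mul_le_mul_left ?_ ht0
    linarith
  have hlim : Tendsto (fun t : ℝ => s + 2 * c * ⟪p, d⟫ + t * (c * ‖d‖ ^ 2)) (𝓝[>] 0)
      (𝓝 (s + 2 * c * ⟪p, d⟫)) := by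
    have hcont : Continuous fun t : ℝ => s + 2 * c * ⟪p, d⟫ + t * (c * ‖d‖ ^ 2) := by fun_prop
    simpa using (hcont.tendsto 0).mono_left nhdsWithin_le_nhds
  exact ge_of_tendsto hlim (eventually_of_mem (Ioo_mem_nhdsGT one_pos) key)

/-- With `f` proper convex lower semicontinuous, `α > 0`, and `x` such
that `f(x + ιh₀) < +∞` for some `h₀`: every point `x + ιh` satisfies the same condition, and
the map `h ↦ P(x + ιh, α)` is Lipschitz with constant at most `1`: if `p` and `q` are the
minimizers of the Moreau–Yosida functional at `x + ιh` and `x + ιk` respectively, then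
`|p - q|_H ≤ |h - k|_H`. -/
theorem moreauYosida_min_lipschitz (ι : H →L[ℝ] X) (hι : Function.Injective ι)
    (f : X → EReal) (hbot : ∀ y : X, f y ≠ ⊥) (hproper : ∃ y : X, f y ≠ ⊤)
    (hconv : ∀ (x y : X) (a b : ℝ), 0 ≤ a → 0 ≤ b → a + b = 1 →
      f (a • x + b • y) ≤ (a : EReal) * f x + (b : EReal) * f y)
    (hlsc : LowerSemicontinuous f)
    (α : ℝ) (hα : 0 < α) (x : X) (hx : ∃ h₀ : H, f (x + ι h₀) ≠ ⊤) :
    (∀ h : H, ∃ h₀ : H, f (x + ι h + ι h₀) ≠ ⊤) ∧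
      ∀ (h k p q : H),
        (∀ h' : H,
          f (x + ι h + ι p) + (((1 / (2 * α)) * ‖p‖ ^ 2 : ℝ) : EReal) ≤
            f (x + ι h + ι h') + (((1 / (2 * α)) * ‖h'‖ ^ 2 : ℝ) : EReal)) →
        (∀ h' : H,
          f (x + ι k + ι q) + (((1 / (2 * α)) * ‖q‖ ^ 2 : ℝ) : EReal) ≤
            f (x + ι k + ι h') + (((1 / (2 * α)) * ‖h'‖ ^ 2 : ℝ) : EReal)) →
        ‖p - q‖ ≤ ‖h - k‖ := by
  obtain ⟨h₀, hh₀⟩ := hx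
  have hfin : ∀ h : H, ∃ h₀ : H, f (x + ι h + ι h₀) ≠ ⊤ := fun h =>
    ⟨h₀ - h, by rwa [map_sub, add_assoc, add_sub_cancel]⟩
  refine ⟨hfin, fun h k p q hp hq => ?_⟩
  have hreal : ∀ h p : H, (∀ h' : H,
      f (x + ι h + ι p) + (((1 / (2 * α)) * ‖p‖ ^ 2 : ℝ) : EReal) ≤
        f (x + ι h + ι h') + (((1 / (2 * α)) * ‖h'‖ ^ 2 : ℝ) : EReal)) →
      ∃ r : ℝ, f (x + ι h + ι p) = r := by
    intro h p hp
    obtain ⟨h', hh'⟩ := hfin h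
    refine ⟨_, (EReal.coe_toReal (fun htop => ?_) (hbot _)).symm⟩
    have hle := hp h'
    rw [htop, EReal.top_add_coe, top_le_iff] at hle
    exact EReal.add_ne_top hh' (EReal.coe_ne_top _) hle
  obtain ⟨r, hr⟩ := hreal h p hp
  obtain ⟨s, hs⟩ := hreal k q hq
  have hpq := le_add_inner_of_regularized_min (d := (k + q) - (h + p)) hconv hp hr
    (s := s) (by rw [← hs]; congr 1; simp only [map_add, map_sub]; abel)
  have hqp := le_add_inner_of_regularized_min (d := (h + p) - (k + q)) hconv hq hs
    (s := r) (by rw [← hr]; congr 1; simp only [map_add, map_sub]; abel)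
  have hc : 0 < 2 * (1 / (2 * α)) := by positivity
  have hsum : 0 ≤ ⟪p, (k + q) - (h + p)⟫ + ⟪q, (h + p) - (k + q)⟫ := by
    refine nonneg_of_mul_nonneg_right ?_ hc
    linarith
  have hid : ⟪p, (k + q) - (h + p)⟫ + ⟪q, (h + p) - (k + q)⟫ =
      ⟪p - q, k - h⟫ - ‖p - q‖ ^ 2 := by
    rw [← real_inner_self_eq_norm_sq]
    simp only [inner_sub_left, inner_sub_right, inner_add_right]
    ring
  have hcs := real_inner_le_norm (p - q) (k - h)
  rw [norm_sub_rev k h] at hcs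
  by_contra! hlt
  nlinarith [norm_nonneg (h - k)]
end

section
/- Let f : X → ℝ ∪ {+∞} be proper, convex and lower semicontinuous, and let x ∈ X. Then for all 0 < α' ≤ α one has f_α(x) ≤ f_{α'}(x) ≤ f(x) (in ℝ ∪ {±∞}), and f_α(x) converges monotonically to f(x) as α → 0⁺, i.e. sup_{α>0} f_α(x) = lim_{α→0⁺} f_α(x) = f(x) in ℝ ∪ {+∞}. -/
open scoped ENNReal RealInnerProductSpace
open Filter Topology

variable {X H : Type*}
  [NormedAddCommGroup X] [NormedSpace ℝ X] [CompleteSpace X]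
  [NormedAddCommGroup H] [InnerProductSpace ℝ H] [CompleteSpace H]

/-- A proper convex lower semicontinuous function on a normed space has a minorant of the form
`y ↦ -C - K * ‖y‖`. -/
theorem exists_norm_minorant_of_convex_lsc {E : Type*} [NormedAddCommGroup E] [NormedSpace ℝ E]
    {f : E → EReal} (hbot : ∀ y : E, f y ≠ ⊥) (hproper : ∃ y : E, f y ≠ ⊤)
    (hconv : ∀ (x y : E) (a b : ℝ), 0 ≤ a → 0 ≤ b → a + b = 1 →
      f (a • x + b • y) ≤ (a : EReal) * f x + (b : EReal) * f y)
    (hlsc : LowerSemicontinuous f) :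
    ∃ C K : ℝ, 0 ≤ K ∧ ∀ y, ((-C - K * ‖y‖ : ℝ) : EReal) ≤ f y := by
  obtain ⟨y₀, hy₀⟩ := hproper
  obtain ⟨m, hm⟩ : ∃ m : ℝ, f y₀ = m := ⟨_, (EReal.coe_toReal hy₀ (hbot y₀)).symm⟩
  have hlt : ((m - 1 : ℝ) : EReal) < f y₀ := by
    rw [hm]; exact_mod_cast sub_one_lt m
  obtain ⟨δ, hδ, hball⟩ := Metric.eventually_nhds_iff.1 (hlsc y₀ _ hlt)
  have key : ∀ y, ((m - 1 - 2 / δ * ‖y - y₀‖ : ℝ) : EReal) ≤ f y := by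
    intro y
    rcases lt_or_ge ‖y - y₀‖ δ with hr | hr
    · refine le_trans ?_ (hball (by rwa [dist_eq_norm])).le
      have : 0 ≤ 2 / δ * ‖y - y₀‖ := by positivity
      exact_mod_cast (by linarith : m - 1 - 2 / δ * ‖y - y₀‖ ≤ m - 1)
    · by_cases htop : f y = ⊤
      · simp [htop]
      obtain ⟨v, hv⟩ : ∃ v : ℝ, f y = v := ⟨_, (EReal.coe_toReal htop (hbot y)).symm⟩
      have hr0 : 0 < ‖y - y₀‖ := hδ.trans_le hr
      set r := ‖y - y₀‖ with hrdef
      set t : ℝ := δ / (2 * r) with ht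
      have ht0 : 0 < t := by positivity
      have ht1 : t ≤ 1 := by rw [ht, div_le_one (by positivity)]; linarith
      have htr : 2 / δ * r * t = 1 := by rw [ht]; field_simp
      have hdist : dist ((1 - t) • y₀ + t • y) y₀ < δ := by
        have h : (1 - t) • y₀ + t • y - y₀ = t • (y - y₀) := by module
        rw [dist_eq_norm, h, norm_smul, Real.norm_of_nonneg ht0.le, ← hrdef]
        have : t * r = δ / 2 := by rw [ht]; field_simp
        linarith
      have h := (hball hdist).trans_le
        (hconv y₀ y (1 - t) t (by linarith) ht0.le (by ring))
      rw [hm, hv] at h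
      have h' : m - 1 < (1 - t) * m + t * v := by exact_mod_cast h
      rw [hv]
      refine EReal.coe_le_coe_iff.2 (le_of_mul_le_mul_right ?_ ht0)
      nlinarith
  refine ⟨-(m - 1) + 2 / δ * ‖y₀‖, 2 / δ, by positivity, fun y => le_trans ?_ (key y)⟩
  refine EReal.coe_le_coe_iff.2 ?_
  have h : 2 / δ * ‖y - y₀‖ ≤ 2 / δ * (‖y‖ + ‖y₀‖) := by gcongr; exact norm_sub_le _ _
  linarith

theorem moreauYosidaH_le (ι : H →L[ℝ] X) (f : X → EReal) (α : ℝ) (x : X) :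
    moreauYosidaH ι f α x ≤ f x :=
  (iInf_le _ 0).trans (by simp)

theorem moreauYosidaH_le_of_le (ι : H →L[ℝ] X) (f : X → EReal) {α α' : ℝ} (hα' : 0 < α')
    (h : α' ≤ α) (x : X) : moreauYosidaH ι f α x ≤ moreauYosidaH ι f α' x := by
  refine iInf_mono fun v => add_le_add le_rfl (EReal.coe_le_coe_iff.2 ?_)
  gcongr

/-- Under a norm minorant, every real number below `f x` is eventually a lower bound for
`moreauYosidaH ι f α x` as `α → 0⁺`. -/
theorem eventually_le_moreauYosidaH (ι : H →L[ℝ] X) {f : X → EReal} {C K : ℝ} (hK : 0 ≤ K)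
    (hmin : ∀ y, ((-C - K * ‖y‖ : ℝ) : EReal) ≤ f y) {x : X}
    (hlsc : LowerSemicontinuousAt f x) {c : ℝ} (hc : (c : EReal) < f x) :
    ∀ᶠ α in 𝓝[>] (0 : ℝ), (c : EReal) ≤ moreauYosidaH ι f α x := by
  have hcont : Tendsto (fun h : H => x + ι h) (𝓝 0) (𝓝 x) := by
    have : Continuous fun h : H => x + ι h := by fun_prop
    simpa using this.tendsto 0
  obtain ⟨δ, hδ, hball⟩ := Metric.eventually_nhds_iff.1 (hcont.eventually (hlsc c hc))
  set D : ℝ := |C + K * ‖x‖ + c| with hD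
  set M : ℝ := (K * ‖ι‖ + D / δ) / δ with hM
  have hlim : Tendsto (fun α : ℝ => 1 / 2 * α⁻¹) (𝓝[>] 0) atTop :=
    tendsto_inv_nhdsGT_zero.const_mul_atTop (by norm_num)
  filter_upwards [hlim.eventually_ge_atTop M, self_mem_nhdsWithin] with α hα hα0
  have hα0 : 0 < α := hα0
  have hcoef : 1 / (2 * α) = 1 / 2 * α⁻¹ := by field_simp
  refine le_iInf fun h => ?_
  rcases lt_or_ge ‖h‖ δ with hr | hr
  · have h1 : (c : EReal) ≤ f (x + ι h) := (hball (by simpa using hr)).le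
    have h2 : (0 : EReal) ≤ ((1 / (2 * α) * ‖h‖ ^ 2 : ℝ) : EReal) :=
      EReal.coe_nonneg.2 (by positivity)
    simpa using add_le_add h1 h2
  · refine le_trans ?_ (add_le_add (hmin (x + ι h)) le_rfl)
    rw [← EReal.coe_add, EReal.coe_le_coe_iff, hcoef]
    have hn : K * ‖x + ι h‖ ≤ K * (‖x‖ + ‖ι‖ * ‖h‖) := by
      gcongr
      exact (norm_add_le _ _).trans (add_le_add le_rfl (ι.le_opNorm h))
    have hDnn : 0 ≤ D := abs_nonneg _
    have hquad : K * ‖ι‖ * ‖h‖ + D ≤ 1 / 2 * α⁻¹ * ‖h‖ ^ 2 := calc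
      K * ‖ι‖ * ‖h‖ + D = K * ‖ι‖ * ‖h‖ + D / δ * δ := by field_simp
      _ ≤ K * ‖ι‖ * ‖h‖ + D / δ * ‖h‖ := by gcongr
      _ = M * δ * ‖h‖ := by rw [hM]; field_simp
      _ ≤ M * ‖h‖ * ‖h‖ := by gcongr
      _ = M * ‖h‖ ^ 2 := by ring
      _ ≤ _ := by gcongr
    have := le_abs_self (C + K * ‖x‖ + c)
    linarith

/-- Let `f : X → ℝ ∪ {+∞}` be proper, convex and lower semicontinuous,
and let `x ∈ X`. Then for all `0 < α' ≤ α` one has `f_α(x) ≤ f_{α'}(x) ≤ f(x)`, and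
`f_α(x)` converges monotonically to `f(x)` as `α → 0⁺`:
`sup_{α>0} f_α(x) = lim_{α→0⁺} f_α(x) = f(x)`. -/
theorem moreauYosidaH_tendsto (ι : H →L[ℝ] X) (hι : Function.Injective ι)
    (f : X → EReal) (hbot : ∀ y : X, f y ≠ ⊥) (hproper : ∃ y : X, f y ≠ ⊤)
    (hconv : ∀ (x y : X) (a b : ℝ), 0 ≤ a → 0 ≤ b → a + b = 1 →
      f (a • x + b • y) ≤ (a : EReal) * f x + (b : EReal) * f y)
    (hlsc : LowerSemicontinuous f) (x : X) :
    (∀ α α' : ℝ, 0 < α' → α' ≤ α →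
        moreauYosidaH ι f α x ≤ moreauYosidaH ι f α' x ∧ moreauYosidaH ι f α' x ≤ f x) ∧
      (⨆ α ∈ Set.Ioi (0 : ℝ), moreauYosidaH ι f α x) = f x ∧
      Tendsto (fun α : ℝ => moreauYosidaH ι f α x) (𝓝[>] 0) (𝓝 (f x)) := by
  obtain ⟨C, K, hK, hmin⟩ := exists_norm_minorant_of_convex_lsc hbot hproper hconv hlsc
  have hlim : Tendsto (fun α : ℝ => moreauYosidaH ι f α x) (𝓝[>] 0) (𝓝 (f x)) := by
    refine tendsto_order.2 ⟨fun a ha => ?_, fun a ha =>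
      .of_forall fun α => (moreauYosidaH_le ι f α x).trans_lt ha⟩
    obtain ⟨c, hac, hc⟩ := EReal.lt_iff_exists_real_btwn.1 ha
    exact (eventually_le_moreauYosidaH ι hK hmin (hlsc x) hc).mono fun α => hac.trans_le
  refine ⟨fun α α' hα' h => ⟨moreauYosidaH_le_of_le ι f hα' h x, moreauYosidaH_le ι f α' x⟩,
    le_antisymm (iSup₂_le fun α _ => moreauYosidaH_le ι f α x) ?_, hlim⟩
  refine le_of_tendsto hlim ?_
  filter_upwards [self_mem_nhdsWithin] with α hα
  exact le_iSup₂ (f := fun α (_ : α ∈ Set.Ioi (0 : ℝ)) => moreauYosidaH ι f α x) α hα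
end

section
/- Let f : X → ℝ ∪ {+∞} be proper, convex and lower semicontinuous, let α > 0, and let x ∈ X be such that f(x + ιh₀) < +∞ for some h₀ ∈ H. Then the function F_α : H → ℝ, F_α(h) := f_α(x + ιh), is real-valued and Fréchet differentiable at every h ∈ H, with gradient (in H) given by ∇F_α(h) = −(1/α) P(x + ιh, α). In particular f_α is differentiable along H with H-gradient ∇_H f_α = −α⁻¹ P(·,α). -/
open scoped ENNReal RealInnerProductSpace
open Filter Topology

variable {X H : Type*}
  [NormedAddCommGroup X] [NormedSpace ℝ X] [CompleteSpace X]
  [NormedAddCommGroup H] [InnerProductSpace ℝ H] [CompleteSpace H]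

/-- A function which agrees with an affine one up to a quadratic error has a gradient. -/
lemma hasGradientAt_of_abs_sub_le_mul_sq {E : Type*} [NormedAddCommGroup E]
    [InnerProductSpace ℝ E] [CompleteSpace E] {F : E → ℝ} {g a : E} {C : ℝ}
    (hF : ∀ k, |F k - F a - ⟪g, k - a⟫| ≤ C * ‖k - a‖ ^ 2) : HasGradientAt F g a := by
  rw [hasGradientAt_iff_isLittleO]
  refine (Asymptotics.IsBigO.of_bound C (Eventually.of_forall fun k => ?_)).trans_isLittleO
    (Asymptotics.isLittleO_pow_sub_sub a one_lt_two)
  simpa using hF k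

/-- First-order optimality for the proximal problem: if `p` minimizes
`h ↦ φ (h) + ‖h‖ ^ 2 / (2 * α)` with `φ` convex, then `-α⁻¹ • p` is a subgradient of `φ` at `p`. -/
lemma subgradient_of_forall_prox_le {E : Type*} [NormedAddCommGroup E] [InnerProductSpace ℝ E]
    {φ : E → EReal} {α u v : ℝ} {p q : E} (hα : 0 < α)
    (hconv : ∀ t : ℝ, 0 < t → t < 1 →
      φ ((1 - t) • p + t • q) ≤ ((1 - t : ℝ) : EReal) * φ p + (t : EReal) * φ q)
    (hu : φ p = u) (hv : φ q = v)
    (hmin : ∀ h, φ p + (((1 / (2 * α)) * ‖p‖ ^ 2 : ℝ) : EReal) ≤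
      φ h + (((1 / (2 * α)) * ‖h‖ ^ 2 : ℝ) : EReal)) :
    u - 1 / α * ⟪p, q - p⟫ ≤ v := by
  have key : ∀ t : ℝ, 0 < t → t < 1 →
      u - v - 1 / α * ⟪p, q - p⟫ ≤ t * (1 / (2 * α) * ‖q - p‖ ^ 2) := by
    intro t h0 h1
    have h2 := (hmin ((1 - t) • p + t • q)).trans (add_le_add_left (hconv t h0 h1) _)
    rw [hu, hv] at h2
    norm_cast at h2
    have h3 : ‖(1 - t) • p + t • q‖ ^ 2
        = ‖p‖ ^ 2 + 2 * t * ⟪p, q - p⟫ + t ^ 2 * ‖q - p‖ ^ 2 := by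
      have : (1 - t) • p + t • q = p + t • (q - p) := by module
      rw [this, norm_add_sq_real, inner_smul_right, norm_smul, mul_pow, Real.norm_eq_abs, sq_abs]
      ring
    rw [h3] at h2
    have h4 : (1 / α : ℝ) = 2 * (1 / (2 * α)) := by field_simp
    rw [h4]
    refine le_of_mul_le_mul_left ?_ h0
    linarith
  have hlim : Tendsto (fun t : ℝ => t * (1 / (2 * α) * ‖q - p‖ ^ 2)) (𝓝[>] 0) (𝓝 0) := by
    have : Continuous fun t : ℝ => t * (1 / (2 * α) * ‖q - p‖ ^ 2) := by fun_prop
    simpa using (this.tendsto 0).mono_left nhdsWithin_le_nhds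
  have := ge_of_tendsto hlim (Filter.mem_of_superset (Ioo_mem_nhdsGT one_pos)
    fun t ht => key t ht.1 ht.2)
  linarith

/-- With `f` proper convex lower semicontinuous, `α > 0`, and `x` such
that `f(x + ιh₀) < +∞` for some `h₀`: the function `F_α(h) = f_α(x + ιh)` is real-valued and
Fréchet differentiable at every `h ∈ H`, with gradient `∇F_α(h) = -(1/α) P(x + ιh, α)`,
where `P(x + ιh, α)` is the minimizer of the Moreau–Yosida functional at `x + ιh`. -/
theorem hasGradientAt_moreauYosidaH (ι : H →L[ℝ] X) (hι : Function.Injective ι)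
    (f : X → EReal) (hbot : ∀ y : X, f y ≠ ⊥) (hproper : ∃ y : X, f y ≠ ⊤)
    (hconv : ∀ (x y : X) (a b : ℝ), 0 ≤ a → 0 ≤ b → a + b = 1 →
      f (a • x + b • y) ≤ (a : EReal) * f x + (b : EReal) * f y)
    (hlsc : LowerSemicontinuous f)
    (α : ℝ) (hα : 0 < α) (x : X) (hx : ∃ h₀ : H, f (x + ι h₀) ≠ ⊤) :
    ∀ (h p : H),
      (∀ h' : H,
        f (x + ι h + ι p) + (((1 / (2 * α)) * ‖p‖ ^ 2 : ℝ) : EReal) ≤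
          f (x + ι h + ι h') + (((1 / (2 * α)) * ‖h'‖ ^ 2 : ℝ) : EReal)) →
      (moreauYosidaH ι f α (x + ι h) ≠ ⊤ ∧ moreauYosidaH ι f α (x + ι h) ≠ ⊥) ∧
        HasGradientAt (fun k : H => (moreauYosidaH ι f α (x + ι k)).toReal)
          ((-(1 / α)) • p) h := by
  intro h p hp
  have hfin : f (x + ι h + ι p) ≠ ⊤ := by
    obtain ⟨h₀, hh₀⟩ := hx
    intro htop
    have h1 := hp (h₀ - h)
    rw [htop, show x + ι h + ι (h₀ - h) = x + ι h₀ by rw [map_sub]; abel,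
      EReal.top_add_coe, top_le_iff] at h1
    exact (EReal.add_lt_top hh₀ (EReal.coe_ne_top _)).ne h1
  obtain ⟨u, hu⟩ : ∃ u : ℝ, f (x + ι h + ι p) = u :=
    ⟨_, (EReal.coe_toReal hfin (hbot _)).symm⟩
  have hsub : ∀ (q : H) (v : ℝ), f (x + ι h + ι q) = v → u - 1 / α * ⟪p, q - p⟫ ≤ v := by
    intro q v hv
    refine subgradient_of_forall_prox_le (φ := fun k => f (x + ι h + ι k)) hα ?_ hu hv hp
    intro t h0 h1
    have h2 := hconv (x + ι h + ι p) (x + ι h + ι q) (1 - t) t (by linarith) h0.le (by ring)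
    convert h2 using 2
    simp only [map_add, map_smul]
    module
  have hα2 : (1 / α : ℝ) = 2 * (1 / (2 * α)) := by field_simp
  have hupper : ∀ k : H, moreauYosidaH ι f α (x + ι k) ≤
      ((u + 1 / (2 * α) * ‖p‖ ^ 2 - 1 / α * ⟪p, k - h⟫ + 1 / (2 * α) * ‖k - h‖ ^ 2 : ℝ) :
        EReal) := by
    intro k
    refine (iInf_le _ (p - (k - h))).trans ?_
    rw [show x + ι k + ι (p - (k - h)) = x + ι h + ι p by simp only [map_sub]; abel, hu]
    norm_cast
    rw [norm_sub_sq_real, hα2]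
    linarith
  have hlower : ∀ k : H,
      ((u + 1 / (2 * α) * ‖p‖ ^ 2 - 1 / α * ⟪p, k - h⟫ : ℝ) : EReal) ≤
        moreauYosidaH ι f α (x + ι k) := by
    intro k
    refine le_iInf fun r => ?_
    have hr : x + ι k + ι r = x + ι h + ι (k - h + r) := by
      simp only [map_sub, map_add]; abel
    by_cases htop : f (x + ι k + ι r) = ⊤
    · rw [htop, EReal.top_add_coe]
      exact le_top
    obtain ⟨v, hv⟩ : ∃ v : ℝ, f (x + ι k + ι r) = v :=
      ⟨_, (EReal.coe_toReal htop (hbot _)).symm⟩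
    have h1 := hsub _ v (hr ▸ hv)
    rw [hv]
    norm_cast
    rw [inner_sub_right, inner_add_right, real_inner_self_eq_norm_sq] at h1
    have h2 : 0 ≤ 1 / (2 * α) * ‖r - p‖ ^ 2 := by positivity
    rw [norm_sub_sq_real, real_inner_comm] at h2
    rw [hα2] at h1 ⊢
    linarith
  have hne_top : ∀ k : H, moreauYosidaH ι f α (x + ι k) ≠ ⊤ := fun k =>
    ne_top_of_le_ne_top (EReal.coe_ne_top _) (hupper k)
  have hne_bot : ∀ k : H, moreauYosidaH ι f α (x + ι k) ≠ ⊥ := fun k =>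
    ne_bot_of_le_ne_bot (EReal.coe_ne_bot _) (hlower k)
  refine ⟨⟨hne_top h, hne_bot h⟩, hasGradientAt_of_abs_sub_le_mul_sq (C := 1 / (2 * α)) ?_⟩
  have hU := fun k => EReal.toReal_le_toReal (hupper k) (hne_bot k) (EReal.coe_ne_top _)
  have hL := fun k => EReal.toReal_le_toReal (hlower k) (EReal.coe_ne_bot _) (hne_top k)
  simp only [EReal.toReal_coe] at hU hL
  intro k
  have hUh := hU h
  have hLh := hL h
  simp only [sub_self, inner_zero_right, norm_zero] at hUh hLh
  rw [inner_smul_left, abs_le]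
  simp only [conj_trivial]
  have h0 : 0 ≤ 1 / (2 * α) * ‖k - h‖ ^ 2 := by positivity
  constructor <;> linarith [hU k, hL k]
end

section
/- Let f : X → ℝ ∪ {+∞} be proper, convex and lower semicontinuous, and let α, β > 0. Then the Moreau–Yosida approximation along H of f_α with parameter β equals f_{α+β}: for every x ∈ X, inf{ f_α(x + ιh) + (1/(2β))|h|_H² : h ∈ H } = f_{α+β}(x), where both sides are elements of ℝ ∪ {+∞}. -/
open scoped ENNReal RealInnerProductSpace
open Filter Topology

variable {X H : Type*}
  [NormedAddCommGroup X] [NormedSpace ℝ X] [CompleteSpace X]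
  [NormedAddCommGroup H] [InnerProductSpace ℝ H] [CompleteSpace H]

/-- The quadratic penalty with parameter `α + β` at `u + v` is bounded by the sum of the penalties
with parameter `α` at `v` and `β` at `u`. -/
lemma norm_add_sq_div_add_le {E : Type*} [SeminormedAddCommGroup E] {α β : ℝ}
    (hα : 0 < α) (hβ : 0 < β) (u v : E) :
    1 / (2 * (α + β)) * ‖u + v‖ ^ 2 ≤ 1 / (2 * α) * ‖v‖ ^ 2 + 1 / (2 * β) * ‖u‖ ^ 2 := by
  have htri : ‖u + v‖ ^ 2 ≤ (‖v‖ + ‖u‖) ^ 2 := by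
    have := norm_add_le v u
    rw [add_comm u v]
    gcongr
  have hcs : (‖v‖ + ‖u‖) ^ 2 / (α + β) ≤ ‖v‖ ^ 2 / α + ‖u‖ ^ 2 / β := by
    rw [div_add_div _ _ hα.ne' hβ.ne', div_le_div_iff₀ (by positivity) (by positivity)]
    nlinarith [sq_nonneg (β * ‖v‖ - α * ‖u‖)]
  calc 1 / (2 * (α + β)) * ‖u + v‖ ^ 2
      ≤ 1 / (2 * (α + β)) * (‖v‖ + ‖u‖) ^ 2 := by gcongr
    _ = (‖v‖ + ‖u‖) ^ 2 / (α + β) / 2 := by field_simp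
    _ ≤ (‖v‖ ^ 2 / α + ‖u‖ ^ 2 / β) / 2 := by gcongr
    _ = 1 / (2 * α) * ‖v‖ ^ 2 + 1 / (2 * β) * ‖u‖ ^ 2 := by field_simp

/-- Let `f : X → ℝ ∪ {+∞}` be proper, convex and lower semicontinuous,
and `α, β > 0`. Then the Moreau–Yosida approximation along `H` of `f_α` with parameter `β`
equals `f_{α+β}`: `(f_α)_β(x) = f_{α+β}(x)` for every `x ∈ X`. -/
theorem moreauYosidaH_moreauYosidaH (ι : H →L[ℝ] X) (hι : Function.Injective ι)
    (f : X → EReal) (hbot : ∀ y : X, f y ≠ ⊥) (hproper : ∃ y : X, f y ≠ ⊤)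
    (hconv : ∀ (x y : X) (a b : ℝ), 0 ≤ a → 0 ≤ b → a + b = 1 →
      f (a • x + b • y) ≤ (a : EReal) * f x + (b : EReal) * f y)
    (hlsc : LowerSemicontinuous f)
    (α β : ℝ) (hα : 0 < α) (hβ : 0 < β) (x : X) :
    moreauYosidaH ι (fun y => moreauYosidaH ι f α y) β x = moreauYosidaH ι f (α + β) x := by
  apply le_antisymm
  · refine le_iInf fun k => ?_
    have hαβ : α + β ≠ 0 := by positivity
    calc moreauYosidaH ι (fun y => moreauYosidaH ι f α y) β x
        ≤ moreauYosidaH ι f α (x + ι ((β / (α + β)) • k)) +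
            ((1 / (2 * β) * ‖(β / (α + β)) • k‖ ^ 2 : ℝ) : EReal) :=
          iInf_le _ ((β / (α + β)) • k)
      _ ≤ f (x + ι ((β / (α + β)) • k) + ι ((α / (α + β)) • k)) +
            ((1 / (2 * α) * ‖(α / (α + β)) • k‖ ^ 2 : ℝ) : EReal) +
            ((1 / (2 * β) * ‖(β / (α + β)) • k‖ ^ 2 : ℝ) : EReal) := by
          gcongr
          exact iInf_le _ ((α / (α + β)) • k)
      _ = f (x + ι k) + ((1 / (2 * (α + β)) * ‖k‖ ^ 2 : ℝ) : EReal) := by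
          rw [add_assoc (f _), ← EReal.coe_add, add_assoc x, ← map_add, ← add_smul, ← add_div,
            add_comm β α, div_self hαβ, one_smul, norm_smul, norm_smul, Real.norm_of_nonneg
            (by positivity), Real.norm_of_nonneg (by positivity)]
          congr 2
          field_simp
  · refine le_iInf fun u => ?_
    rw [← EReal.sub_le_iff_le_add (Or.inl (EReal.coe_ne_bot _)) (Or.inl (EReal.coe_ne_top _))]
    refine le_iInf fun v => ?_
    rw [EReal.sub_le_iff_le_add (Or.inl (EReal.coe_ne_bot _)) (Or.inl (EReal.coe_ne_top _))]
    refine (iInf_le _ (u + v)).trans ?_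
    rw [add_assoc (f _), ← EReal.coe_add, add_assoc x, ← map_add]
    gcongr
    exact norm_add_sq_div_add_le hα hβ u v
end

section
/- Let f : X → ℝ ∪ {+∞} be proper, convex and lower semicontinuous, let α, β > 0, and let x ∈ X be such that f(x + ιh₀) < +∞ for some h₀ ∈ H. Then (1/(α+β)) |P(x, α+β)|_H ≤ (1/α) |P(x, α)|_H; that is, the norm |∇_H f_α(x)|_H = α⁻¹|P(x,α)|_H of the H-gradient of the Moreau–Yosida approximation is nonincreasing in α. -/
open scoped ENNReal RealInnerProductSpace
open Filter Topology

variable {X H : Type*}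
  [NormedAddCommGroup X] [NormedSpace ℝ X] [CompleteSpace X]
  [NormedAddCommGroup H] [InnerProductSpace ℝ H] [CompleteSpace H]

theorem nonpos_of_forall_le_mul {d K : ℝ} (hK : 0 ≤ K)
    (h : ∀ t : ℝ, 0 < t → t ≤ 1 → d ≤ t * K) : d ≤ 0 := by
  by_contra! hd
  have hs : 0 < d + K := by linarith
  have h1 := h (d / (d + K)) (by positivity) ((div_le_one hs).2 (by linarith))
  rw [div_mul_eq_mul_div, le_div_iff₀ hs] at h1
  nlinarith

/-- A minimizer of `h ↦ f (x + ι h) + c * ‖h‖ ^ 2` has finite value as soon as `f` is finite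
somewhere on `x + ι H`. -/
theorem ne_top_of_forall_add_sq_le {X H : Type*} [NormedAddCommGroup X] [NormedSpace ℝ X]
    [NormedAddCommGroup H] [InnerProductSpace ℝ H] {ι : H →L[ℝ] X} {f : X → EReal} {c : ℝ}
    {x : X} {p h : H} (hh : f (x + ι h) ≠ ⊤)
    (hp : f (x + ι p) + ((c * ‖p‖ ^ 2 : ℝ) : EReal) ≤
      f (x + ι h) + ((c * ‖h‖ ^ 2 : ℝ) : EReal)) : f (x + ι p) ≠ ⊤ := by
  intro h0
  rw [h0, EReal.top_add_coe, top_le_iff] at hp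
  exact EReal.add_ne_top hh (EReal.coe_ne_top _) hp

/-- The first-order optimality condition for a minimizer of `h ↦ f (x + ι h) + c * ‖h‖ ^ 2`
with `f` convex. -/
theorem toReal_le_add_inner_of_forall_add_sq_le {X H : Type*} [NormedAddCommGroup X]
    [NormedSpace ℝ X] [NormedAddCommGroup H] [InnerProductSpace ℝ H]
    {ι : H →L[ℝ] X} {f : X → EReal} (hbot : ∀ y : X, f y ≠ ⊥)
    (hconv : ∀ (x y : X) (a b : ℝ), 0 ≤ a → 0 ≤ b → a + b = 1 →
      f (a • x + b • y) ≤ (a : EReal) * f x + (b : EReal) * f y)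
    {c : ℝ} (hc : 0 ≤ c) {x : X} {p h : H} (hh : f (x + ι h) ≠ ⊤)
    (hp : ∀ h : H, f (x + ι p) + ((c * ‖p‖ ^ 2 : ℝ) : EReal) ≤
      f (x + ι h) + ((c * ‖h‖ ^ 2 : ℝ) : EReal)) :
    (f (x + ι p)).toReal ≤ (f (x + ι h)).toReal + 2 * c * ⟪p, h - p⟫ := by
  have hA := EReal.coe_toReal (ne_top_of_forall_add_sq_le hh (hp h)) (hbot _)
  have hB := EReal.coe_toReal hh (hbot _)
  set A := (f (x + ι p)).toReal
  set B := (f (x + ι h)).toReal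
  suffices A - B - 2 * c * ⟪p, h - p⟫ ≤ 0 by linarith
  refine nonpos_of_forall_le_mul (K := c * ‖h - p‖ ^ 2) (by positivity) fun t ht0 ht1 => ?_
  have hcv := hconv (x + ι p) (x + ι h) (1 - t) t (by linarith) ht0.le (by ring)
  have hpt : (1 - t) • (x + ι p) + t • (x + ι h) = x + ι (p + t • (h - p)) := by
    simp only [map_add, map_smul, map_sub]
    module
  rw [hpt, ← hA, ← hB] at hcv
  have hmin := (hp (p + t • (h - p))).trans (add_le_add_left hcv _)
  rw [← hA] at hmin
  norm_cast at hmin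
  rw [norm_add_sq_real, norm_smul, inner_smul_right, mul_pow, Real.norm_eq_abs, sq_abs] at hmin
  refine le_of_mul_le_mul_left ?_ ht0
  linarith

/-- If `u` and `v` pair monotonically with `-(α + β) • u` and `-α • v`, where `0 ≤ α` and `0 < β`,
then `‖u‖ ≤ ‖v‖`. -/
theorem norm_le_of_inner_sub_nonneg {H : Type*} [NormedAddCommGroup H] [InnerProductSpace ℝ H]
    {α β : ℝ} (hα : 0 ≤ α) (hβ : 0 < β) {u v : H}
    (h : 0 ≤ ⟪u - v, α • v - (α + β) • u⟫) : ‖u‖ ≤ ‖v‖ := by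
  have e : α • v - (α + β) • u = -(α • (u - v)) - β • u := by module
  rw [e, inner_sub_right, inner_neg_right, inner_smul_right, inner_smul_right,
    real_inner_self_eq_norm_sq, inner_sub_left, real_inner_self_eq_norm_sq] at h
  have hsq : 0 ≤ α * ‖u - v‖ ^ 2 := by positivity
  have hle : ‖u‖ ^ 2 ≤ ⟪v, u⟫ := by
    refine le_of_mul_le_mul_left ?_ hβ
    linarith
  have := real_inner_le_norm v u
  nlinarith [norm_nonneg u, norm_nonneg v]

/-- With `f` proper convex lower semicontinuous, `α, β > 0`, and `x` such
that `f(x + ιh₀) < +∞` for some `h₀`: if `p = P(x, α+β)` and `q = P(x, α)` are the minimizers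
of the corresponding Moreau–Yosida functionals, then
`(1/(α+β))|P(x, α+β)|_H ≤ (1/α)|P(x, α)|_H`; i.e. `|∇_H f_α(x)|_H` is nonincreasing in `α`. -/
theorem norm_gradient_moreauYosidaH_antitone (ι : H →L[ℝ] X) (hι : Function.Injective ι)
    (f : X → EReal) (hbot : ∀ y : X, f y ≠ ⊥) (hproper : ∃ y : X, f y ≠ ⊤)
    (hconv : ∀ (x y : X) (a b : ℝ), 0 ≤ a → 0 ≤ b → a + b = 1 →
      f (a • x + b • y) ≤ (a : EReal) * f x + (b : EReal) * f y)
    (hlsc : LowerSemicontinuous f)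
    (α β : ℝ) (hα : 0 < α) (hβ : 0 < β) (x : X) (hx : ∃ h₀ : H, f (x + ι h₀) ≠ ⊤)
    (p q : H)
    (hp : ∀ h : H,
      f (x + ι p) + (((1 / (2 * (α + β))) * ‖p‖ ^ 2 : ℝ) : EReal) ≤
        f (x + ι h) + (((1 / (2 * (α + β))) * ‖h‖ ^ 2 : ℝ) : EReal))
    (hq : ∀ h : H,
      f (x + ι q) + (((1 / (2 * α)) * ‖q‖ ^ 2 : ℝ) : EReal) ≤
        f (x + ι h) + (((1 / (2 * α)) * ‖h‖ ^ 2 : ℝ) : EReal)) :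
    (1 / (α + β)) * ‖p‖ ≤ (1 / α) * ‖q‖ := by
  obtain ⟨h₀, hh₀⟩ := hx
  have hab : 0 < α + β := by linarith
  have h1 := toReal_le_add_inner_of_forall_add_sq_le hbot hconv (by positivity)
    (ne_top_of_forall_add_sq_le hh₀ (hq h₀)) hp
  have h2 := toReal_le_add_inner_of_forall_add_sq_le hbot hconv (by positivity)
    (ne_top_of_forall_add_sq_le hh₀ (hp h₀)) hq
  have e1 : 2 * (1 / (2 * (α + β))) = 1 / (α + β) := by field_simp
  have e2 : 2 * (1 / (2 * α)) = 1 / α := by field_simp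
  rw [e1] at h1
  rw [e2, ← neg_sub q p, inner_neg_right] at h2
  have key : 0 ≤ ⟪(1 / (α + β)) • p - (1 / α) • q,
      α • ((1 / α) • q) - (α + β) • ((1 / (α + β)) • p)⟫ := by
    rw [smul_smul, smul_smul, mul_one_div_cancel hα.ne', mul_one_div_cancel hab.ne', one_smul,
      one_smul, inner_sub_left, real_inner_smul_left, real_inner_smul_left]
    linarith
  have := norm_le_of_inner_sub_nonneg hα.le hβ key
  rwa [norm_smul, norm_smul, Real.norm_of_nonneg (by positivity),
    Real.norm_of_nonneg (by positivity)] at this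
end

section
/- Let f : X → ℝ ∪ {+∞} be proper, convex and lower semicontinuous, let x ∈ X with f(x) < +∞, and suppose k ∈ H satisfies f(x + ιh) ≥ f(x) + ⟨k, h⟩_H for every h ∈ H (i.e. k is a subgradient at 0 of h ↦ f(x + ιh)). Then for every α > 0, |P(x,α)|_H ≤ α |k|_H; equivalently, |∇_H f_α(x)|_H = α⁻¹|P(x,α)|_H ≤ |k|_H. -/
open scoped ENNReal RealInnerProductSpace
open Filter Topology

variable {X H : Type*}
  [NormedAddCommGroup X] [NormedSpace ℝ X] [CompleteSpace X]
  [NormedAddCommGroup H] [InnerProductSpace ℝ H] [CompleteSpace H]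

/-- Let `f` be proper convex lower semicontinuous, `x ∈ X` with
`f(x) < +∞`, and suppose `k ∈ H` satisfies `f(x + ιh) ≥ f(x) + ⟪k, h⟫_H` for every `h ∈ H`
(`k` is a subgradient at `0` of `h ↦ f(x + ιh)`). Then for every `α > 0`, the minimizer
`P(x,α)` of the Moreau–Yosida functional satisfies `|P(x,α)|_H ≤ α |k|_H`. -/
theorem norm_moreauYosida_min_le (ι : H →L[ℝ] X) (hι : Function.Injective ι)
    (f : X → EReal) (hbot : ∀ y : X, f y ≠ ⊥) (hproper : ∃ y : X, f y ≠ ⊤)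
    (hconv : ∀ (x y : X) (a b : ℝ), 0 ≤ a → 0 ≤ b → a + b = 1 →
      f (a • x + b • y) ≤ (a : EReal) * f x + (b : EReal) * f y)
    (hlsc : LowerSemicontinuous f)
    (x : X) (hfx : f x ≠ ⊤)
    (k : H) (hk : ∀ h : H, f x + ((⟪k, h⟫ : ℝ) : EReal) ≤ f (x + ι h)) :
    ∀ α : ℝ, 0 < α → ∀ p : H,
      (∀ h : H,
        f (x + ι p) + (((1 / (2 * α)) * ‖p‖ ^ 2 : ℝ) : EReal) ≤
          f (x + ι h) + (((1 / (2 * α)) * ‖h‖ ^ 2 : ℝ) : EReal)) →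
      ‖p‖ ≤ α * ‖k‖ := by
  intro α hα p hp
  have hp0 := hp 0
  have hk_p := hk p
  lift f x to ℝ using ⟨hfx, hbot x⟩ with a ha
  have htop : f (x + ι p) ≠ ⊤ := by
    intro htop
    rw [htop, EReal.top_add_coe, map_zero, add_zero, ← ha, ← EReal.coe_add] at hp0
    exact EReal.coe_ne_top _ (top_le_iff.mp hp0)
  lift f (x + ι p) to ℝ using ⟨htop, hbot _⟩ with b hb
  have hsub : a + ⟪k, p⟫ ≤ b := by exact_mod_cast hk_p
  -- Compare `p` with the points `(1 - t) • p` of the segment from `p` to `0`.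
  have hseg : ∀ t : ℝ, 0 < t → t < 1 → b + (2 - t) * ((1 / (2 * α)) * ‖p‖ ^ 2) ≤ a := by
    intro t ht0 ht1
    have hc := hconv (x + ι p) x (1 - t) t (by linarith) ht0.le (by ring)
    have hpt : (1 - t) • (x + ι p) + t • x = x + ι ((1 - t) • p) := by
      rw [map_smul]
      module
    rw [hpt, ← ha, ← hb] at hc
    have hmin := (hp ((1 - t) • p)).trans (add_le_add_left hc _)
    have hreal : b + (1 / (2 * α)) * ‖p‖ ^ 2 ≤
        (1 - t) * b + t * a + (1 / (2 * α)) * ‖(1 - t) • p‖ ^ 2 := by exact_mod_cast hmin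
    rw [norm_smul, mul_pow, Real.norm_eq_abs, sq_abs] at hreal
    refine le_of_mul_le_mul_left ?_ ht0
    linarith
  have hlim : b + (2 - 0) * ((1 / (2 * α)) * ‖p‖ ^ 2) ≤ a := by
    have hcont : Continuous fun t : ℝ => b + (2 - t) * ((1 / (2 * α)) * ‖p‖ ^ 2) := by fun_prop
    refine le_of_tendsto ((hcont.tendsto 0).mono_left (nhdsWithin_le_nhds (s := Set.Ioi 0))) ?_
    filter_upwards [Ioo_mem_nhdsGT (zero_lt_one' ℝ)] with t ht using hseg t ht.1 ht.2
  have hinner : -(‖k‖ * ‖p‖) ≤ ⟪k, p⟫ := neg_le_of_abs_le (abs_real_inner_le_norm k p)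
  have hsq : ‖p‖ ^ 2 / α ≤ ‖k‖ * ‖p‖ := by
    have heq : (2 - 0) * ((1 / (2 * α)) * ‖p‖ ^ 2) = ‖p‖ ^ 2 / α := by field_simp; norm_num
    linarith
  rw [div_le_iff₀ hα] at hsq
  rcases (norm_nonneg p).eq_or_lt with hzero | hpos
  · rw [← hzero]
    positivity
  · refine le_of_mul_le_mul_right ?_ hpos
    linarith
end

section
/- Let f : X → ℝ ∪ {+∞} be proper, convex and lower semicontinuous, let x ∈ X with f(x) < +∞, and suppose the set K := { k ∈ H : f(x + ιh) ≥ f(x) + ⟨k, h⟩_H for all h ∈ H } is nonempty, with k₀ ∈ K its (unique) element of minimal H-norm. Then −α⁻¹ P(x,α) converges to k₀ strongly in H as α → 0⁺, and |α⁻¹ P(x,α)|_H ≤ |k₀|_H for every α > 0. In particular |∇_H f_α(x)|_H → |k₀|_H as α → 0⁺. -/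
open scoped ENNReal RealInnerProductSpace
open Filter Topology

variable {X H : Type*}
  [NormedAddCommGroup X] [NormedSpace ℝ X] [CompleteSpace X]
  [NormedAddCommGroup H] [InnerProductSpace ℝ H] [CompleteSpace H]

/-- First-order optimality condition for the proximal problem: if `p` minimizes
`g + ‖·‖² / (2α)` with `g` convex, then `-α⁻¹ p` is a subgradient of `g` at `p`. -/
lemma subgradient_of_isMinimizer_add_sq {E : Type*} [NormedAddCommGroup E]
    [InnerProductSpace ℝ E] {g : E → EReal}
    (hconv : ∀ (u v : E) (a b : ℝ), 0 ≤ a → 0 ≤ b → a + b = 1 →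
      g (a • u + b • v) ≤ (a : EReal) * g u + (b : EReal) * g v)
    {α : ℝ} (hα : 0 < α) {p : E}
    (hp : ∀ h : E, g p + (((1 / (2 * α)) * ‖p‖ ^ 2 : ℝ) : EReal) ≤
      g h + (((1 / (2 * α)) * ‖h‖ ^ 2 : ℝ) : EReal))
    {q r : ℝ} {h : E} (hq : g p = q) (hr : g h = r) :
    q + ⟪-(1 / α) • p, h - p⟫ ≤ r := by
  have key : ∀ t : ℝ, 0 < t → t ≤ 1 →
      q - r ≤ (1 / α) * ⟪p, h - p⟫ + t * ((1 / (2 * α)) * ‖h - p‖ ^ 2) := by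
    intro t ht ht1
    have h1 := (hp ((1 - t) • p + t • h)).trans
      (add_le_add_left (hconv p h (1 - t) t (by linarith) ht.le (by ring)) _)
    rw [hq, hr] at h1
    norm_cast at h1
    have h2 : ‖(1 - t) • p + t • h‖ ^ 2
        = ‖p‖ ^ 2 + 2 * (t * ⟪p, h - p⟫) + t ^ 2 * ‖h - p‖ ^ 2 := by
      rw [show (1 - t) • p + t • h = p + t • (h - p) by module, norm_add_sq_real,
        inner_smul_right, norm_smul, mul_pow, Real.norm_eq_abs, sq_abs]
    rw [h2] at h1
    have h3 : 1 / α = 2 * (1 / (2 * α)) := by field_simp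
    rw [h3]
    refine le_of_mul_le_mul_left ?_ ht
    linarith
  have hlim : Tendsto (fun t : ℝ => (1 / α) * ⟪p, h - p⟫ + t * ((1 / (2 * α)) * ‖h - p‖ ^ 2))
      (𝓝[>] 0) (𝓝 ((1 / α) * ⟪p, h - p⟫ + 0 * ((1 / (2 * α)) * ‖h - p‖ ^ 2))) :=
    (Continuous.tendsto (by fun_prop) 0).mono_left nhdsWithin_le_nhds
  have hle := ge_of_tendsto hlim (by
    filter_upwards [Ioc_mem_nhdsGT (zero_lt_one' ℝ)] with t ht using key t ht.1 ht.2)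
  rw [inner_smul_left]
  simp only [conj_trivial]
  linarith

/-- If `⟪u - v, α u - β v⟫ ≤ 0` with `0 < α < β`, then `‖v‖ ≤ ‖u‖` and the decrease of the
squared norm controls the distance between `u` and `v`. -/
lemma norm_sub_sq_le_of_inner_smul_sub_nonpos {E : Type*} [NormedAddCommGroup E]
    [InnerProductSpace ℝ E] {u v : E} {α β : ℝ} (hα : 0 < α) (hαβ : α < β)
    (h : ⟪u - v, α • u - β • v⟫ ≤ 0) : ‖u - v‖ ^ 2 ≤ ‖u‖ ^ 2 - ‖v‖ ^ 2 := by
  have h1 : (α + β) * ‖u - v‖ ^ 2 ≤ (β - α) * (‖u‖ ^ 2 - ‖v‖ ^ 2) := by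
    simp only [inner_sub_left, inner_sub_right, inner_smul_right,
      real_inner_self_eq_norm_sq, real_inner_comm u v] at h
    rw [norm_sub_sq_real]
    have := real_inner_comm u v
    nlinarith
  nlinarith [sq_nonneg ‖u - v‖]

/-- A bounded curve whose squared increments are dominated by the decrease of the squared norm
has a limit at the left end point of its domain. -/
lemma exists_tendsto_nhdsGT_of_norm_sub_sq_le {E : Type*} [NormedAddCommGroup E]
    [CompleteSpace E] {k : ℝ → E} {a C : ℝ} (hC : ∀ α, a < α → ‖k α‖ ≤ C)
    (hk : ∀ α β, a < α → α < β → ‖k α - k β‖ ^ 2 ≤ ‖k α‖ ^ 2 - ‖k β‖ ^ 2) :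
    ∃ l, Tendsto k (𝓝[>] a) (𝓝 l) := by
  have hbdd : BddAbove ((fun α => ‖k α‖ ^ 2) '' Set.Ioi a) := by
    refine ⟨C ^ 2, ?_⟩
    rintro _ ⟨α, hα, rfl⟩
    exact pow_le_pow_left₀ (norm_nonneg _) (hC α hα) 2
  have hanti : AntitoneOn (fun α => ‖k α‖ ^ 2) (Set.Ioi a) := by
    intro α hα β _ hαβ
    rcases hαβ.eq_or_lt with rfl | hlt
    · exact le_rfl
    · have := hk α β hα hlt
      have := sq_nonneg ‖k α - k β‖
      simp only
      linarith
  have hφ := (hanti.tendsto_nhdsGT hbdd).cauchy_map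
  refine cauchy_map_iff_exists_tendsto.1 (Metric.cauchy_iff.2 ⟨inferInstance, fun ε hε => ?_⟩)
  obtain ⟨t, ht, hdist⟩ := (Metric.cauchy_iff.1 hφ).2 (ε ^ 2) (by positivity)
  refine ⟨_, image_mem_map (inter_mem ht self_mem_nhdsWithin), ?_⟩
  rintro _ ⟨α, ⟨hαt, hα⟩, rfl⟩ _ ⟨β, ⟨hβt, hβ⟩, rfl⟩
  have hαβ := hdist _ hαt _ hβt
  rw [Real.dist_eq] at hαβ
  rw [dist_eq_norm]
  refine lt_of_pow_lt_pow_left₀ 2 hε.le (lt_of_le_of_lt ?_ hαβ)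
  rcases lt_trichotomy α β with hlt | rfl | hlt
  · exact (hk α β hα hlt).trans (le_abs_self _)
  · simp
  · rw [norm_sub_rev, abs_sub_comm]
    exact (hk β α hβ hlt).trans (le_abs_self _)

/-- Let `f` be proper convex lower semicontinuous, `x ∈ X` with
`f(x) < +∞`. Suppose the set `K = {k ∈ H : f(x + ιh) ≥ f(x) + ⟪k, h⟫_H for all h}` is
nonempty with `k₀ ∈ K` its element of minimal norm. If `P α` denotes, for each `α > 0`,
the minimizer of the Moreau–Yosida functional at `x`, then `-(1/α) P(x,α) → k₀` strongly in
`H` as `α → 0⁺`, `|(1/α) P(x,α)|_H ≤ |k₀|_H` for every `α > 0`, and in particular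
`|∇_H f_α(x)|_H = |(1/α) P(x,α)|_H → |k₀|_H` as `α → 0⁺`. -/
theorem gradient_moreauYosidaH_tendsto (ι : H →L[ℝ] X) (hι : Function.Injective ι)
    (f : X → EReal) (hbot : ∀ y : X, f y ≠ ⊥) (hproper : ∃ y : X, f y ≠ ⊤)
    (hconv : ∀ (x y : X) (a b : ℝ), 0 ≤ a → 0 ≤ b → a + b = 1 →
      f (a • x + b • y) ≤ (a : EReal) * f x + (b : EReal) * f y)
    (hlsc : LowerSemicontinuous f)
    (x : X) (hfx : f x ≠ ⊤)
    (k₀ : H) (hk₀ : ∀ h : H, f x + ((⟪k₀, h⟫ : ℝ) : EReal) ≤ f (x + ι h))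
    (hk₀min : ∀ k : H, (∀ h : H, f x + ((⟪k, h⟫ : ℝ) : EReal) ≤ f (x + ι h)) → ‖k₀‖ ≤ ‖k‖)
    (P : ℝ → H)
    (hP : ∀ α : ℝ, 0 < α → ∀ h : H,
      f (x + ι (P α)) + (((1 / (2 * α)) * ‖P α‖ ^ 2 : ℝ) : EReal) ≤
        f (x + ι h) + (((1 / (2 * α)) * ‖h‖ ^ 2 : ℝ) : EReal)) :
    Tendsto (fun α : ℝ => (-(1 / α)) • P α) (𝓝[>] 0) (𝓝 k₀) ∧
      (∀ α : ℝ, 0 < α → ‖(1 / α) • P α‖ ≤ ‖k₀‖) ∧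
      Tendsto (fun α : ℝ => ‖(1 / α) • P α‖) (𝓝[>] 0) (𝓝 ‖k₀‖) := by
  have hconvH : ∀ (u v : H) (a b : ℝ), 0 ≤ a → 0 ≤ b → a + b = 1 →
      f (x + ι (a • u + b • v)) ≤ (a : EReal) * f (x + ι u) + (b : EReal) * f (x + ι v) := by
    intro u v a b ha hb hab
    have hcomb : x + ι (a • u + b • v) = a • (x + ι u) + b • (x + ι v) := by
      rw [map_add, map_smul, map_smul]
      nth_rewrite 1 [← one_smul ℝ x]
      rw [← hab]
      module
    rw [hcomb]
    exact hconv _ _ a b ha hb hab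
  obtain ⟨c, hc⟩ : ∃ c : ℝ, f x = c := ⟨_, (EReal.coe_toReal hfx (hbot x)).symm⟩
  have hfin : ∀ α : ℝ, 0 < α → ∃ q : ℝ, f (x + ι (P α)) = q := by
    intro α hα
    refine ⟨_, (EReal.coe_toReal (fun htop => ?_) (hbot _)).symm⟩
    have h0 := hP α hα 0
    rw [htop, EReal.top_add_coe, map_zero, add_zero, hc, ← EReal.coe_add] at h0
    exact EReal.coe_ne_top _ (top_le_iff.1 h0)
  choose! q hq using hfin
  set k : ℝ → H := fun α => (-(1 / α)) • P α with hkdef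
  have hPk : ∀ α : ℝ, 0 < α → P α = -(α • k α) := by
    intro α hα
    simp [hkdef, smul_smul, hα.ne']
  have hsub : ∀ α : ℝ, 0 < α → ∀ (h : H) (r : ℝ), f (x + ι h) = r →
      q α + ⟪k α, h - P α⟫ ≤ r := fun α hα h r hr =>
    subgradient_of_isMinimizer_add_sq (g := fun h => f (x + ι h)) hconvH hα (hP α hα) (hq α hα) hr
  have hq₀ : ∀ α : ℝ, 0 < α → c + ⟪k₀, P α⟫ ≤ q α := by
    intro α hα
    have h := hk₀ (P α)
    rw [hc, hq α hα] at h
    exact_mod_cast h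
  have hinner : ∀ α : ℝ, 0 < α → ‖k α‖ ^ 2 ≤ ⟪k₀, k α⟫ := by
    intro α hα
    have h1 := hsub α hα 0 c (by simpa using hc)
    have h2 := hq₀ α hα
    rw [hPk α hα] at h1 h2
    simp only [sub_neg_eq_add, zero_add, inner_neg_right, inner_smul_right,
      real_inner_self_eq_norm_sq] at h1 h2
    exact le_of_mul_le_mul_left (by linarith) hα
  have hbound : ∀ α : ℝ, 0 < α → ‖k α‖ ≤ ‖k₀‖ := by
    intro α hα
    have h1 := (hinner α hα).trans (real_inner_le_norm _ _)
    rcases (norm_nonneg (k α)).eq_or_lt with h0 | h0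
    · exact h0 ▸ norm_nonneg _
    · exact le_of_mul_le_mul_right (by linarith [sq ‖k α‖]) h0
  have hmono : ∀ α β : ℝ, 0 < α → α < β → ‖k α - k β‖ ^ 2 ≤ ‖k α‖ ^ 2 - ‖k β‖ ^ 2 := by
    intro α β hα hαβ
    have hβ := hα.trans hαβ
    refine norm_sub_sq_le_of_inner_smul_sub_nonpos hα hαβ ?_
    have h1 := hsub α hα (P β) (q β) (hq β hβ)
    have h2 := hsub β hβ (P α) (q α) (hq α hα)
    rw [hPk α hα, hPk β hβ] at h1 h2
    simp only [inner_sub_left, inner_sub_right, inner_neg_right] at h1 h2 ⊢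
    linarith
  obtain ⟨l, hl⟩ := exists_tendsto_nhdsGT_of_norm_sub_sq_le hbound hmono
  have hid : Tendsto (fun α : ℝ => α) (𝓝[>] 0) (𝓝 0) := nhdsWithin_le_nhds
  have hP0 : Tendsto P (𝓝[>] 0) (𝓝 0) := by
    have h := (hid.smul hl).neg
    rw [zero_smul, neg_zero] at h
    refine h.congr' ?_
    filter_upwards [self_mem_nhdsWithin] with α hα using (hPk α hα).symm
  have hlK : ∀ h : H, f x + ((⟪l, h⟫ : ℝ) : EReal) ≤ f (x + ι h) := by
    intro h
    by_cases htop : f (x + ι h) = ⊤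
    · exact htop ▸ le_top
    obtain ⟨r, hr⟩ : ∃ r : ℝ, f (x + ι h) = r := ⟨_, (EReal.coe_toReal htop (hbot _)).symm⟩
    have hlim : Tendsto (fun α => c + ⟪k₀, P α⟫ + ⟪k α, h - P α⟫) (𝓝[>] 0)
        (𝓝 (c + ⟪k₀, (0 : H)⟫ + ⟪l, h - 0⟫)) :=
      (tendsto_const_nhds.add (tendsto_const_nhds.inner hP0)).add
        (hl.inner (tendsto_const_nhds.sub hP0))
    have hle := le_of_tendsto hlim (b := r) (by
      filter_upwards [self_mem_nhdsWithin] with α hα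
      linarith [hsub α hα h r hr, hq₀ α hα])
    rw [inner_zero_right, add_zero, sub_zero] at hle
    rw [hc, hr]
    exact_mod_cast hle
  have hl_eq : l = k₀ := by
    have h1 : ‖l‖ ^ 2 ≤ ⟪k₀, l⟫ := le_of_tendsto_of_tendsto (hl.norm.pow 2)
      (tendsto_const_nhds.inner hl) (by
        filter_upwards [self_mem_nhdsWithin] with α hα using hinner α hα)
    have h2 := pow_le_pow_left₀ (norm_nonneg _) (hk₀min l hlK) 2
    have h3 : ‖k₀ - l‖ ^ 2 ≤ 0 := by
      rw [norm_sub_sq_real]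
      linarith
    exact (sub_eq_zero.1 (norm_eq_zero.1 (pow_eq_zero_iff two_ne_zero |>.1
      (le_antisymm h3 (sq_nonneg _))))).symm
  rw [hl_eq] at hl
  have hnorm : ∀ α : ℝ, ‖(1 / α) • P α‖ = ‖k α‖ := fun α => by
    simp only [hkdef, neg_smul, norm_neg]
  refine ⟨hl, fun α hα => (hnorm α).trans_le (hbound α hα), ?_⟩
  simp only [hnorm]
  exact hl.norm
end
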